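/- arXiv:1707.02656 — 4 statements merged into one kernel-verified Lean document; each statement's English description precedes it below -/
import Mathlib

section
/- Let A be a commutative ring, J a finite nonempty set, and (u_I) a family of elements of A indexed by the nonempty subsets I of J. For every nonempty subset H ⊆ J define the joint cumulant κ_H := Σ_{π ∈ 𝒫(H)} (−1)^{#π−1}(#π−1)! Π_{B∈π} u_B. Then for every nonempty subset H ⊆ J one has the Möbius inversion formula u_H = Σ_{π ∈ 𝒫(H)} Π_{B∈π} κ_B. -/
open Finset

open scoped Classical

noncomputable section

/-! ### Set partitions -/

/-- `π` is a set partition of the finite set `H`. -/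
def IsSetPartition {α : Type*} (π : Finset (Finset α)) (H : Finset α) : Prop :=
  (∀ B ∈ π, B ⊆ H) ∧ (∀ B ∈ π, B.Nonempty) ∧
    (∀ B ∈ π, ∀ C ∈ π, B ≠ C → Disjoint B C) ∧ (∀ a ∈ H, ∃ B ∈ π, a ∈ B)

/-- The finite set of all set partitions of `H`. -/
def setPartitions {α : Type*} (H : Finset α) : Finset (Finset (Finset α)) :=
  H.powerset.powerset.filter (fun π => IsSetPartition π H)

/-- The joint cumulant of the family `u` on the subset `H`. -/
def jointCumulant {A : Type*} [CommRing A] {ι : Type*} (u : Finset ι → A) (H : Finset ι) : A :=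
  ∑ π ∈ setPartitions H,
    (-1 : A) ^ (π.card - 1) * ((π.card - 1).factorial : A) * ∏ B ∈ π, u B

/-! ### Multigraphs -/

/-- Number of edges of the multigraph with endpoint map `ends` whose endpoint set is `{i,j}`. -/
def eCnt {V E : Type*} [Fintype E] (ends : E → Sym2 V) (i j : V) : ℕ :=
  (univ.filter fun e => ends e = s(i, j)).card

/-- The spanning subgraph `(V, S)` is connected. -/
def SConnected {V E : Type*} (ends : E → Sym2 V) (S : Finset E) : Prop :=
  ∀ v w : V, Relation.ReflTransGen (fun a b => ∃ e ∈ S, ends e = s(a, b)) v w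

/-- The subgraph `(B, S)` is connected. -/
def SConnectedOn {V E : Type*} (ends : E → Sym2 V) (B : Finset V) (S : Finset E) : Prop :=
  ∀ v ∈ B, ∀ w ∈ B, Relation.ReflTransGen (fun a b => ∃ e ∈ S, ends e = s(a, b)) v w

/-- `E|_B`: the edges with both endpoints in `B`. -/
def edgesIn {V E : Type*} [Fintype E] (ends : E → Sym2 V) (B : Finset V) : Finset E :=
  univ.filter fun e => ∀ v ∈ ends e, v ∈ B

/-- `c_{G|_B}(q) = Σ_{S ⊆ E|_B, (B,S) connected} q^{#S}` as a polynomial in `q`. -/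
def connPoly {V E : Type*} [Fintype E] (ends : E → Sym2 V) (B : Finset V) : Polynomial ℤ :=
  ∑ S ∈ (edgesIn ends B).powerset.filter (fun S => SConnectedOn ends B S),
    Polynomial.X ^ S.card

/-- Number of edges joining `w` to some vertex of `B`. -/
def dCnt {V E : Type*} [Fintype E] (ends : E → Sym2 V) (B : Finset V) (w : V) : ℕ :=
  (univ.filter fun e => ∃ b ∈ B, ends e = s(w, b)).card

/-! ### The `G`-inversion polynomial -/

/-- `[m]_q = 1 + q + ⋯ + q^{m-1}`. -/
def nq {R : Type*} [CommSemiring R] (q : R) (m : ℕ) : R := ∑ k ∈ Finset.range m, q ^ k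

/-- Rooted spanning trees (encoded by parent maps, rooted at `0`) of the simple graph `G̃`
underlying the multigraph on `Fin (r+1)` with edge multiplicities `e`. -/
def parentMaps {r : ℕ} (e : Fin (r+1) → Fin (r+1) → ℕ) : Finset (Fin (r+1) → Fin (r+1)) :=
  univ.filter fun p => p 0 = 0 ∧ (∀ w, w ≠ 0 → p w ≠ w ∧ 0 < e w (p w)) ∧ ∀ w, ∃ k, p^[k] w = 0

/-- `(i,j)` is a `κ`-inversion of the spanning tree encoded by `p`. -/
def isKappaInv {r : ℕ} (e : Fin (r+1) → Fin (r+1) → ℕ) (p : Fin (r+1) → Fin (r+1))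
    (i j : Fin (r+1)) : Prop :=
  i ≠ 0 ∧ j ≠ 0 ∧ i ≠ j ∧ (∃ k, p^[k] j = i) ∧ j < i ∧ p i ≠ j ∧ 0 < e j (p i)

/-- `κ(T) = Σ_{(i,j) κ-inversion} e_{parent(i), j}`. -/
def kappaStat {r : ℕ} (e : Fin (r+1) → Fin (r+1) → ℕ) (p : Fin (r+1) → Fin (r+1)) : ℕ :=
  ∑ pr ∈ (univ ×ˢ univ : Finset (Fin (r+1) × Fin (r+1))).filter
    (fun pr => isKappaInv e p pr.1 pr.2), e (p pr.1) pr.2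

/-- `δ_T(w) = Σ_u e_{u, parent(w)}`, `u` ranging over descendants of `w` together with `w`. -/
def deltaStat {r : ℕ} (e : Fin (r+1) → Fin (r+1) → ℕ) (p : Fin (r+1) → Fin (r+1))
    (w : Fin (r+1)) : ℕ :=
  ∑ u ∈ univ.filter (fun u => ∃ k, p^[k] u = w), e u (p w)

/-- The `G`-inversion polynomial `𝓘_G(q)` of the multigraph on `Fin (r+1)` with
edge multiplicities `e`, evaluated at an element `q` of a commutative (semi)ring. -/
def Iinv {r : ℕ} {R : Type*} [CommSemiring R] (e : Fin (r+1) → Fin (r+1) → ℕ) (q : R) : R :=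
  q ^ (∑ i, e i i) *
    ∑ p ∈ parentMaps e, q ^ kappaStat e p * ∏ w ∈ univ.erase (0 : Fin (r+1)), nq q (e w (p w))

/-! ### Partitions, Young diagrams and fillings -/

/-- `f : ℕ → ℕ` encodes a partition: `f j` is the `j`-th part (for `j ≥ 1`). -/
def IsPartitionFun (f : ℕ → ℕ) : Prop := Antitone f ∧ ∃ N, f N = 0

/-- The number of (nonempty) rows of the diagram of `f`. -/
def nRows (f : ℕ → ℕ) : ℕ := sSup {j | f j ≠ 0}

/-- `λ^t_i`: the length of the `i`-th column of the diagram of `f`. -/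
def colLen (f : ℕ → ℕ) (i : ℕ) : ℕ :=
  ((Finset.Icc 1 (nRows f)).filter (fun j => i ≤ f j)).card

/-- The cells `(i,j)`, `1 ≤ i ≤ f j`, `j ≥ 1`, of the Young diagram of `f`
(French convention, `i` the column index and `j` the row index). -/
def cells (f : ℕ → ℕ) : Finset (ℕ × ℕ) :=
  (Finset.Icc 1 (f 1) ×ˢ Finset.Icc 1 (nRows f)).filter (fun c => c.1 ≤ f c.2)

/-- Fillings of the diagram of `f` with entries in `{1, …, N}`, encoded as functions
`ℕ × ℕ → ℕ` vanishing outside the diagram. -/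
def fillings (f : ℕ → ℕ) (N : ℕ) : Finset ((ℕ × ℕ) → ℕ) :=
  ((cells f).pi (fun _ => Finset.Icc 1 N)).image
    (fun g c => if h : c ∈ cells f then g c h else 0)

/-- The descent set of a filling. -/
def desSet (f : ℕ → ℕ) (σ : (ℕ × ℕ) → ℕ) : Finset (ℕ × ℕ) :=
  (cells f).filter (fun c => 2 ≤ c.2 ∧ σ (c.1, c.2 - 1) < σ c)

/-- `maj(σ) = Σ_{□ ∈ Des(σ)} (leg(□) + 1)`. -/
def majStat (f : ℕ → ℕ) (σ : (ℕ × ℕ) → ℕ) : ℕ :=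
  ∑ c ∈ desSet f σ, (colLen f c.1 - c.2 + 1)

/-- The counterclockwise-increasing condition defining inversion pairs; the box below `c1`
is read via `σ`, which vanishes off the diagram (giving the convention `σ(□_3) = 0`). -/
def invTriple (σ : (ℕ × ℕ) → ℕ) (c1 c2 : ℕ × ℕ) : Prop :=
  (σ c1 ≤ σ (c1.1, c1.2 - 1) ∧ σ (c1.1, c1.2 - 1) < σ c2) ∨
  (σ (c1.1, c1.2 - 1) < σ c2 ∧ σ c2 < σ c1) ∨
  (σ c2 < σ c1 ∧ σ c1 ≤ σ (c1.1, c1.2 - 1))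

/-- The set of inversion pairs of a filling. -/
def invPairs (f : ℕ → ℕ) (σ : (ℕ × ℕ) → ℕ) : Finset ((ℕ × ℕ) × (ℕ × ℕ)) :=
  ((cells f) ×ˢ (cells f)).filter
    (fun pr => pr.1.2 = pr.2.2 ∧ pr.1.1 < pr.2.1 ∧ invTriple σ pr.1 pr.2)

/-- `inv(σ)`: the number of inversion pairs. -/
def invStat (f : ℕ → ℕ) (σ : (ℕ × ℕ) → ℕ) : ℕ := (invPairs f σ).card

/-! ### The ring `ℤ[q, t, x₁, x₂, …]` and Macdonald polynomials -/

/-- The polynomial ring `ℤ[q, t, x₀, x₁, x₂, …]`. -/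
abbrev MR : Type := MvPolynomial (Fin 2 ⊕ ℕ) ℤ

/-- The variable `q`. -/
def qv : MR := MvPolynomial.X (Sum.inl 0)

/-- The variable `t`. -/
def tv : MR := MvPolynomial.X (Sum.inl 1)

/-- The variable `x_k`. -/
def xv (k : ℕ) : MR := MvPolynomial.X (Sum.inr k)

/-- Haglund's formula: the modified Macdonald polynomial in the variables `x_1, …, x_N`. -/
def macH (f : ℕ → ℕ) (N : ℕ) : MR :=
  ∑ σ ∈ fillings f N, qv ^ invStat f σ * tv ^ majStat f σ * ∏ c ∈ cells f, xv (σ c)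

/-- `λ^B = ⊕_{b ∈ B} λ^b`. -/
def lamB {r : ℕ} (lam : Fin (r+1) → ℕ → ℕ) (B : Finset (Fin (r+1))) : ℕ → ℕ :=
  fun j => ∑ b ∈ B, lam b j

/-- The (unnormalized) Macdonald cumulant
`Σ_{π ∈ 𝒫([r])} (-1)^{#π-1} (#π-1)! Π_{B ∈ π} H̃_{λ^B}`. -/
def macCumulant {r : ℕ} (lam : Fin (r+1) → ℕ → ℕ) (N : ℕ) : MR :=
  ∑ π ∈ setPartitions (univ : Finset (Fin (r+1))),
    (-1 : MR) ^ (π.card - 1) * ((π.card - 1).factorial : MR) * ∏ B ∈ π, macH (lamB lam B) N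

/-! ### Coloring of the diagram `λ^B` -/

/-- Labels `(b, i)`, `b ∈ B`, `1 ≤ i ≤ λ^b_1`, of the columns of the diagrams `λ^b`, `b ∈ B`. -/
def columnPairs {r : ℕ} (lam : Fin (r+1) → ℕ → ℕ) (B : Finset (Fin (r+1))) :
    Finset (Fin (r+1) × ℕ) :=
  (B ×ˢ Finset.Icc 1 (lamB lam B 1)).filter (fun p => p.2 ≤ lam p.1 1)

/-- The column `p'` comes weakly before the column `p` in the sorted order
(longer first; ties first by color, then by column index). -/
def colBefore {r : ℕ} (lam : Fin (r+1) → ℕ → ℕ) (p' p : Fin (r+1) × ℕ) : Prop :=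
  colLen (lam p.1) p.2 < colLen (lam p'.1) p'.2 ∨
    (colLen (lam p'.1) p'.2 = colLen (lam p.1) p.2 ∧
      (p'.1 < p.1 ∨ (p'.1 = p.1 ∧ p'.2 ≤ p.2)))

/-- The position in `λ^B` of the column `i` of `λ^b`. -/
def posIn {r : ℕ} (lam : Fin (r+1) → ℕ → ℕ) (B : Finset (Fin (r+1)))
    (b : Fin (r+1)) (i : ℕ) : ℕ :=
  ((columnPairs lam B).filter (fun p' => colBefore lam p' (b, i))).card

/-- The label `(b, i)` of the column of `λ^B` at position `c`. -/
def colAt {r : ℕ} (lam : Fin (r+1) → ℕ → ℕ) (B : Finset (Fin (r+1))) (c : ℕ) :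
    Fin (r+1) × ℕ :=
  if h : ∃ p ∈ columnPairs lam B, posIn lam B p.1 p.2 = c then h.choose else (0, 1)

/-- The filling `σ^B` of `λ^B` induced from a filling `σ` of `λ^{[r]}` via the
identification of boxes given by the coloring. -/
def inducedFilling {r : ℕ} (lam : Fin (r+1) → ℕ → ℕ) (B : Finset (Fin (r+1)))
    (σ : (ℕ × ℕ) → ℕ) : (ℕ × ℕ) → ℕ :=
  fun cj =>
    if ∃ p ∈ columnPairs lam B, posIn lam B p.1 p.2 = cj.1 then
      σ (posIn lam univ (colAt lam B cj.1).1 (colAt lam B cj.1).2, cj.2)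
    else 0

/-- The color of the column `x` of `λ^{[r]}`. -/
def colColor {r : ℕ} (lam : Fin (r+1) → ℕ → ℕ) (x : ℕ) : Fin (r+1) :=
  (colAt lam univ x).1

/-- Edge multiplicities of the multigraph `G^σ`: the number of inversion pairs of `σ`
colored by `{i, j}`. -/
def eG {r : ℕ} (lam : Fin (r+1) → ℕ → ℕ) (σ : (ℕ × ℕ) → ℕ) (i j : Fin (r+1)) : ℕ :=
  ((invPairs (lamB lam univ) σ).filter (fun pr =>
    (colColor lam pr.1.1 = i ∧ colColor lam pr.2.1 = j) ∨
    (colColor lam pr.1.1 = j ∧ colColor lam pr.2.1 = i))).card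

/-- Edge multiplicities of the multigraph `G^{□_1,…,□_s}` attached to a set `D` of boxes:
for each box of `D` and each box strictly to its left in the same row, one edge joining
the colors of the two columns. -/
def eBox {r : ℕ} (lam : Fin (r+1) → ℕ → ℕ) (D : Finset (ℕ × ℕ)) (i j : Fin (r+1)) : ℕ :=
  ((D ×ˢ cells (lamB lam univ)).filter (fun pr =>
    pr.2.2 = pr.1.2 ∧ pr.2.1 < pr.1.1 ∧
      ((colColor lam pr.2.1 = i ∧ colColor lam pr.1.1 = j) ∨
       (colColor lam pr.2.1 = j ∧ colColor lam pr.1.1 = i)))).card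


/-! ### Summation over set partitions -/

theorem mem_setPartitions {α : Type*} {H : Finset α} {π : Finset (Finset α)} :
    π ∈ setPartitions H ↔ IsSetPartition π H := by
  simp only [setPartitions, mem_filter, mem_powerset, and_iff_right_iff_imp]
  exact fun h B hB => mem_powerset.2 (h.1 B hB)

theorem setPartitions_empty {α : Type*} : setPartitions (∅ : Finset α) = {∅} := by
  ext π
  rw [mem_setPartitions, mem_singleton]
  constructor
  · intro h
    refine eq_empty_of_forall_notMem fun B hB => ?_
    exact (h.2.1 B hB).ne_empty (subset_empty.1 (h.1 B hB))
  · rintro rfl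
    simp [IsSetPartition]

theorem isSetPartition_singleton {α : Type*} {H : Finset α} (hH : H.Nonempty) :
    IsSetPartition {H} H := by
  simp [IsSetPartition, hH]

theorem IsSetPartition.erase {α : Type*} {H B : Finset α} {π : Finset (Finset α)}
    (h : IsSetPartition π H) (hB : B ∈ π) : IsSetPartition (π.erase B) (H \ B) := by
  obtain ⟨hsub, hne, hdisj, hcov⟩ := h
  refine ⟨fun C hC => ?_, fun C hC => hne C (mem_of_mem_erase hC),
    fun C hC D hD => hdisj C (mem_of_mem_erase hC) D (mem_of_mem_erase hD), fun a ha => ?_⟩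
  · obtain ⟨hCB, hC⟩ := mem_erase.1 hC
    exact subset_sdiff.2 ⟨hsub C hC, hdisj C hC B hB hCB⟩
  · obtain ⟨haH, haB⟩ := mem_sdiff.1 ha
    obtain ⟨C, hC, haC⟩ := hcov a haH
    exact ⟨C, mem_erase.2 ⟨by rintro rfl; exact haB haC, hC⟩, haC⟩

theorem IsSetPartition.insert {α : Type*} {H B : Finset α} {π : Finset (Finset α)}
    (h : IsSetPartition π (H \ B)) (hBH : B ⊆ H) (hB : B.Nonempty) :
    IsSetPartition (insert B π) H := by
  obtain ⟨hsub, hne, hdisj, hcov⟩ := h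
  have hd : ∀ C ∈ π, Disjoint C B := fun C hC => (subset_sdiff.1 (hsub C hC)).2
  refine ⟨?_, ?_, ?_, fun a ha => ?_⟩
  · exact forall_mem_insert _ _ _ |>.2 ⟨hBH, fun C hC => (hsub C hC).trans sdiff_subset⟩
  · exact forall_mem_insert _ _ _ |>.2 ⟨hB, hne⟩
  · intro C hC D hD hCD
    rcases mem_insert.1 hC with rfl | hCπ <;> rcases mem_insert.1 hD with rfl | hDπ
    · exact absurd rfl hCD
    · exact (hd D hDπ).symm
    · exact hd C hCπ
    · exact hdisj C hCπ D hDπ hCD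
  · by_cases haB : a ∈ B
    · exact ⟨B, mem_insert_self _ _, haB⟩
    · obtain ⟨C, hC, haC⟩ := hcov a (mem_sdiff.2 ⟨ha, haB⟩)
      exact ⟨C, mem_insert_of_mem hC, haC⟩

theorem IsSetPartition.notMem_of_sdiff {α : Type*} {H B : Finset α} {π : Finset (Finset α)}
    (h : IsSetPartition π (H \ B)) (hB : B.Nonempty) : B ∉ π := fun hBπ =>
  hB.ne_empty (disjoint_self.1 (subset_sdiff.1 (h.1 B hBπ)).2)

theorem IsSetPartition.exists_filter_mem_eq_singleton {α : Type*} {H : Finset α}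
    {π : Finset (Finset α)} (h : IsSetPartition π H) {a : α} (ha : a ∈ H) :
    ∃ B ∈ π, π.filter (fun C => a ∈ C) = {B} := by
  obtain ⟨B, hB, haB⟩ := h.2.2.2 a ha
  refine ⟨B, hB, ?_⟩
  ext C
  simp only [mem_filter, mem_singleton]
  constructor
  · rintro ⟨hC, haC⟩
    by_contra hCB
    exact disjoint_left.1 (h.2.2.1 C hC B hB hCB) haC haB
  · rintro rfl
    exact ⟨hB, haB⟩

theorem IsSetPartition.eq_singleton_of_card_eq_one {α : Type*} {H : Finset α}
    {π : Finset (Finset α)} (h : IsSetPartition π H) (hπ : π.card = 1) : π = {H} := by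
  obtain ⟨B, rfl⟩ := card_eq_one.1 hπ
  rw [singleton_inj]
  refine (h.1 B (mem_singleton_self B)).antisymm fun a ha => ?_
  obtain ⟨C, hC, haC⟩ := h.2.2.2 a ha
  rwa [mem_singleton.1 hC] at haC

/-- Choosing a block of a set partition of `H` amounts to choosing a nonempty `B ⊆ H`
and a set partition of `H \ B`. -/
theorem sum_setPartitions_sum_blocks {α M : Type*} [AddCommMonoid M] (H : Finset α)
    (p : Finset α → Prop) [DecidablePred p] (F : Finset α → Finset (Finset α) → M) :
    ∑ π ∈ setPartitions H, ∑ B ∈ π.filter p, F B (π.erase B) =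
      ∑ B ∈ H.powerset.filter (fun B => B.Nonempty ∧ p B),
        ∑ π ∈ setPartitions (H \ B), F B π := by
  rw [Finset.sum_sigma', Finset.sum_sigma']
  refine Finset.sum_bij' (fun x _ => ⟨x.2, x.1.erase x.2⟩) (fun y _ => ⟨insert y.1 y.2, y.1⟩)
    ?_ ?_ ?_ ?_ ?_
  · rintro ⟨π, B⟩ hx
    simp only [mem_sigma, mem_filter, mem_powerset, mem_setPartitions] at hx ⊢
    exact ⟨⟨hx.1.1 B hx.2.1, hx.1.2.1 B hx.2.1, hx.2.2⟩, hx.1.erase hx.2.1⟩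
  · rintro ⟨B, π⟩ hy
    simp only [mem_sigma, mem_filter, mem_powerset, mem_setPartitions] at hy ⊢
    exact ⟨hy.2.insert hy.1.1 hy.1.2.1, mem_insert_self _ _, hy.1.2.2⟩
  · rintro ⟨π, B⟩ hx
    simp only [mem_sigma, mem_filter] at hx
    simp [insert_erase hx.2.1]
  · rintro ⟨B, π⟩ hy
    simp only [mem_sigma, mem_filter, mem_setPartitions] at hy
    simp [erase_insert (hy.2.notMem_of_sdiff hy.1.2.1)]
  · rintro ⟨π, B⟩ _
    rfl

theorem sum_setPartitions_prod_eq_sum_block {α A : Type*} [CommSemiring A] (f : Finset α → A)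
    {H : Finset α} {a : α} (ha : a ∈ H) :
    ∑ π ∈ setPartitions H, ∏ B ∈ π, f B =
      ∑ B ∈ H.powerset.filter (fun B => B.Nonempty ∧ a ∈ B),
        f B * ∑ π ∈ setPartitions (H \ B), ∏ C ∈ π, f C := by
  simp_rw [mul_sum]
  rw [← sum_setPartitions_sum_blocks H (fun B => a ∈ B) fun B π => f B * ∏ C ∈ π, f C]
  refine sum_congr rfl fun π hπ => ?_
  obtain ⟨B, hB, hfilter⟩ := (mem_setPartitions.1 hπ).exists_filter_mem_eq_singleton ha
  rw [hfilter, sum_singleton, mul_prod_erase π f hB]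

/-! ### The recursion for joint cumulants -/

theorem jointCumulant_add_sum_mul {A ι : Type*} [CommRing A] (u : Finset ι → A)
    {H : Finset ι} {a : ι} (ha : a ∈ H) :
    jointCumulant u H + ∑ C ∈ H.powerset.filter (fun C => C.Nonempty ∧ a ∉ C),
      u C * jointCumulant u (H \ C) = u H := by
  simp_rw [jointCumulant, mul_sum]
  rw [← sum_setPartitions_sum_blocks H (fun C => a ∉ C) fun C π =>
    u C * ((-1 : A) ^ (π.card - 1) * ((π.card - 1).factorial : A) * ∏ B ∈ π, u B),
    ← sum_add_distrib]
  rw [sum_eq_single_of_mem {H} (mem_setPartitions.2 (isSetPartition_singleton ⟨a, ha⟩))]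
  · simp [filter_singleton, ha]
  · intro π hπ hπH
    rw [mem_setPartitions] at hπ
    obtain ⟨B, hB, hfilter⟩ := hπ.exists_filter_mem_eq_singleton ha
    have hcard := card_filter_add_card_filter_not (s := π) (fun C => a ∈ C)
    rw [hfilter, card_singleton] at hcard
    have hne : π.card ≠ 1 := fun h => hπH (hπ.eq_singleton_of_card_eq_one h)
    obtain ⟨m, hm⟩ : ∃ m, π.card = m + 2 := ⟨π.card - 2, by omega⟩
    have hterm : ∀ C ∈ π.filter (fun C => a ∉ C),
        u C * ((-1 : A) ^ ((π.erase C).card - 1) * (((π.erase C).card - 1).factorial : A) *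
          ∏ B ∈ π.erase C, u B) = (-1) ^ m * (m.factorial : A) * ∏ B ∈ π, u B := by
      intro C hC
      have hCπ := (mem_filter.1 hC).1
      rw [card_erase_of_mem hCπ, hm, ← mul_prod_erase π u hCπ]
      simp only [Nat.add_one_sub_one]
      ring
    rw [sum_congr rfl hterm, sum_const, show (π.filter (fun C => a ∉ C)).card = m + 1 by omega,
      hm, show m + 2 - 1 = m + 1 by omega, Nat.factorial_succ]
    push_cast [nsmul_eq_mul]
    ring

theorem sum_setPartitions_prod_jointCumulant {A ι : Type*} [CommRing A] (u : Finset ι → A)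
    (H : Finset ι) (hH : H.Nonempty) :
    ∑ π ∈ setPartitions H, ∏ B ∈ π, jointCumulant u B = u H := by
  induction H using Finset.strongInduction with
  | H H ih =>
  obtain ⟨a, ha⟩ := hH
  rw [sum_setPartitions_prod_eq_sum_block _ ha, ← jointCumulant_add_sum_mul u ha,
    ← add_sum_erase _ _ (mem_filter.2 ⟨mem_powerset_self H, ⟨a, ha⟩, ha⟩)]
  congr 1
  · simp [setPartitions_empty]
  · refine sum_bij' (fun B _ => H \ B) (fun C _ => H \ C) ?_ ?_ ?_ ?_ ?_
    · intro B hB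
      simp only [mem_erase, mem_filter, mem_powerset] at hB ⊢
      refine ⟨sdiff_subset, ?_, by simp [hB.2.2.2]⟩
      exact sdiff_nonempty.2 fun h => hB.1 (hB.2.1.antisymm h)
    · intro C hC
      simp only [mem_erase, mem_filter, mem_powerset] at hC ⊢
      have haC : a ∈ H \ C := mem_sdiff.2 ⟨ha, hC.2.2⟩
      refine ⟨(sdiff_ssubset hC.1 hC.2.1).ne, sdiff_subset, ⟨a, haC⟩, haC⟩
    · intro B hB
      simp only [mem_erase, mem_filter, mem_powerset] at hB
      exact Finset.sdiff_sdiff_eq_self hB.2.1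
    · intro C hC
      simp only [mem_filter, mem_powerset] at hC
      exact Finset.sdiff_sdiff_eq_self hC.1
    · intro B hB
      simp only [mem_erase, mem_filter, mem_powerset] at hB
      rw [ih (H \ B) (sdiff_ssubset hB.2.1 hB.2.2.1)
        (sdiff_nonempty.2 fun h => hB.1 (hB.2.1.antisymm h)),
        Finset.sdiff_sdiff_eq_self hB.2.1, mul_comm]

/-- **Möbius inversion for joint cumulants.**
For a family `u` of elements of a commutative ring indexed by the subsets of a finite
nonempty set `J`, with joint cumulants `κ_H := Σ_{π ∈ 𝒫(H)} (-1)^{#π-1}(#π-1)! Π_{B∈π} u_B`,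
every nonempty `H ⊆ J` satisfies `u_H = Σ_{π ∈ 𝒫(H)} Π_{B∈π} κ_B`. -/
theorem stmt0 {A : Type*} [CommRing A] {ι : Type*} (J : Finset ι) (hJ : J.Nonempty)
    (u : Finset ι → A) :
    ∀ H, H ⊆ J → H.Nonempty →
      u H = ∑ π ∈ setPartitions H, ∏ B ∈ π, jointCumulant u B := by
  exact fun H _ hH => (sum_setPartitions_prod_jointCumulant u H hH).symm

end
end

section
/- Let G = (V,E) be a multigraph. Then, as polynomials in q with integer coefficients, Σ_{S ⊆ E with (V,S) connected} (q−1)^{#S} = Σ_{π ∈ 𝒫(V)} (−1)^{#π−1}(#π−1)! Π_{B∈π} q^{#(E|_B)}. (This is the content of Lemma 3.3: the left-hand side equals (q−1)^{#V−1}·T_G(1,q) by the subgraph expansion of the Tutte polynomial.) -/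
open Finset

open scoped Classical

noncomputable section

/-! ### Sums over equivalence relations -/

instance Setoid.instFintypeOfFintype {α : Type*} [Fintype α] : Fintype (Setoid α) :=
  Fintype.ofInjective (fun r : Setoid α => (r : α → α → Prop)) fun _ _ h =>
    Setoid.ext fun a b => iff_of_eq (congrFun₂ h a b)

lemma card_ker_eq {α β : Type*} [Fintype α] [Fintype β] (r : Setoid α) :
    (univ.filter fun f : α → β => Setoid.ker f = r).card =
      (Fintype.card β).descFactorial (Fintype.card (Quotient r)) := by
  rw [← Fintype.card_embedding_eq, ← Fintype.card_subtype]
  refine Fintype.card_congr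
    { toFun := fun f => ⟨Quotient.lift f.1 fun a b h => ?_, ?_⟩
      invFun := fun g => ⟨fun a => g (Quotient.mk r a), ?_⟩
      left_inv := fun f => rfl
      right_inv := fun g => ?_ }
  · exact (f.2.symm ▸ h : Setoid.ker f.1 a b)
  · rintro ⟨a⟩ ⟨b⟩ h
    exact Quotient.sound (f.2 ▸ (show Setoid.ker f.1 a b from h))
  · ext a b
    exact g.injective.eq_iff.trans Quotient.eq
  · ext ⟨a⟩
    rfl

lemma card_le_ker {α β : Type*} [Fintype α] [Fintype β] (s : Setoid α) :
    (univ.filter fun f : α → β => s ≤ Setoid.ker f).card =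
      Fintype.card β ^ Fintype.card (Quotient s) := by
  rw [← Fintype.card_fun, ← Fintype.card_subtype]
  exact Fintype.card_congr
    { toFun := fun f => Quotient.lift f.1 fun a b h => f.2 h
      invFun := fun g => ⟨fun a => g (Quotient.mk s a), fun a b h =>
        congrArg g (Quotient.sound h)⟩
      left_inv := fun f => rfl
      right_inv := fun g => by ext ⟨a⟩; rfl }

lemma sum_descFactorial_card_quotient {α : Type*} [Fintype α] (s : Setoid α) (n : ℕ) :
    ∑ r : Setoid α with s ≤ r, n.descFactorial (Fintype.card (Quotient r)) =
      n ^ Fintype.card (Quotient s) := by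
  have h := card_le_ker (β := Fin n) s
  rw [Fintype.card_fin] at h
  rw [← h, Finset.card_eq_sum_card_fiberwise (f := Setoid.ker)
    (t := univ.filter fun r => s ≤ r) (by intro f; simp)]
  refine Finset.sum_congr rfl fun r hr => ?_
  have h' := card_ker_eq (β := Fin n) r
  rw [Fintype.card_fin] at h'
  rw [← h', Finset.filter_filter]
  congr 1
  ext f
  simp only [mem_filter, mem_univ, true_and] at hr ⊢
  exact ⟨fun h => ⟨h ▸ hr, h⟩, fun h => h.2⟩

lemma sum_descPochhammer_card_quotient {α : Type*} [Fintype α] (s : Setoid α) :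
    ∑ r : Setoid α with s ≤ r, descPochhammer ℤ (Fintype.card (Quotient r)) =
      Polynomial.X ^ Fintype.card (Quotient s) := by
  refine Polynomial.eq_of_infinite_eval_eq _ _
    ((Set.infinite_range_of_injective (Nat.cast_injective (R := ℤ))).mono ?_)
  rintro _ ⟨n, rfl⟩
  simp only [Set.mem_ofPred_eq, Polynomial.eval_finsetSum, descPochhammer_eval_eq_descFactorial,
    Polynomial.eval_pow, Polynomial.eval_X]
  exact_mod_cast sum_descFactorial_card_quotient s n

lemma descPochhammer_eval_neg_one (n : ℕ) :
    (descPochhammer ℤ n).eval (-1) = (-1) ^ n * (n.factorial : ℤ) := by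
  induction n with
  | zero => simp
  | succ n ih =>
    rw [descPochhammer_succ_right, Polynomial.eval_mul, ih, Nat.factorial_succ]
    simp
    ring

lemma coeff_one_descPochhammer {n : ℕ} (hn : n ≠ 0) :
    (descPochhammer ℤ n).coeff 1 = (-1) ^ (n - 1) * ((n - 1).factorial : ℤ) := by
  obtain ⟨n, rfl⟩ := Nat.exists_eq_succ_of_ne_zero hn
  rw [Nat.succ_eq_add_one, descPochhammer_succ_left, Polynomial.coeff_X_mul,
    Polynomial.coeff_zero_eq_eval_zero, Polynomial.eval_comp, Nat.add_sub_cancel,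
    ← descPochhammer_eval_neg_one]
  simp

lemma sum_moebius_card_quotient {α : Type*} [Fintype α] [Nonempty α] (s : Setoid α) :
    ∑ r : Setoid α with s ≤ r, (-1 : ℤ) ^ (Fintype.card (Quotient r) - 1) *
        ((Fintype.card (Quotient r) - 1).factorial : ℤ) =
      if Fintype.card (Quotient s) = 1 then 1 else 0 := by
  have h := congrArg (fun p => p.coeff 1) (sum_descPochhammer_card_quotient s)
  simp only [Polynomial.finsetSum_coeff, Polynomial.coeff_X_pow] at h
  simp only [eq_comm (b := 1)]
  rw [← h]
  exact Finset.sum_congr rfl fun r _ =>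
    (coeff_one_descPochhammer
      (Fintype.card_pos_iff.2 (Nonempty.map (Quotient.mk r) ‹_›)).ne').symm

/-! ### Set partitions and equivalence relations -/

/-- The finite set of equivalence classes of `r`. -/
def setoidClasses {α : Type*} [Fintype α] (r : Setoid α) : Finset (Finset α) :=
  univ.image fun a => univ.filter fun b => r a b

lemma mem_setoidClasses {α : Type*} [Fintype α] {r : Setoid α} {B : Finset α} :
    B ∈ setoidClasses r ↔ ∃ a, (univ.filter fun b => r a b) = B := by
  simp [setoidClasses]

lemma filter_rel_eq_iff {α : Type*} [Fintype α] {r : Setoid α} {a b : α} :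
    (univ.filter fun c => r a c) = (univ.filter fun c => r b c) ↔ r a b := by
  refine ⟨fun h => ?_, fun h => ?_⟩
  · have hb : b ∈ univ.filter fun c => r a c := by rw [h]; simp
    simpa using hb
  · ext c
    simpa using ⟨fun h' => r.trans (r.symm h) h', fun h' => r.trans h h'⟩

lemma card_setoidClasses {α : Type*} [Fintype α] (r : Setoid α) :
    (setoidClasses r).card = Fintype.card (Quotient r) := by
  let f : Quotient r → Finset α := Quotient.lift (fun a => univ.filter fun b => r a b)
    fun a b h => filter_rel_eq_iff.2 h
  have hf : Function.Injective f := by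
    rintro ⟨a⟩ ⟨b⟩ h
    exact Quotient.sound (filter_rel_eq_iff.1 h)
  rw [← Finset.card_univ, ← Finset.card_image_of_injective _ hf]
  congr 1
  ext B
  simp only [mem_setoidClasses, mem_image, mem_univ, true_and]
  exact ⟨fun ⟨a, h⟩ => ⟨Quotient.mk r a, h⟩, fun ⟨x, h⟩ => by
    induction x using Quotient.inductionOn with | h a => exact ⟨a, h⟩⟩

lemma isSetPartition_setoidClasses {α : Type*} [Fintype α] (r : Setoid α) :
    IsSetPartition (setoidClasses r) univ := by
  refine ⟨fun B _ => subset_univ B, ?_, ?_, fun a _ =>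
    ⟨_, mem_setoidClasses.2 ⟨a, rfl⟩, by simp⟩⟩
  · intro B hB
    obtain ⟨a, rfl⟩ := mem_setoidClasses.1 hB
    exact ⟨a, by simp⟩
  · intro B hB C hC hne
    obtain ⟨a, rfl⟩ := mem_setoidClasses.1 hB
    obtain ⟨b, rfl⟩ := mem_setoidClasses.1 hC
    rw [Finset.disjoint_left]
    intro c hac hbc
    simp only [mem_filter, mem_univ, true_and] at hac hbc
    exact hne (filter_rel_eq_iff.2 (r.trans hac (r.symm hbc)))

lemma setoidClasses_injective {α : Type*} [Fintype α] :
    Function.Injective (setoidClasses (α := α)) := by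
  have key : ∀ (r : Setoid α) (a b : α), r a b ↔ ∃ B ∈ setoidClasses r, a ∈ B ∧ b ∈ B := by
    intro r a b
    constructor
    · exact fun h => ⟨_, mem_setoidClasses.2 ⟨a, rfl⟩, by simp, by simpa using h⟩
    · rintro ⟨B, hB, ha, hb⟩
      obtain ⟨c, rfl⟩ := mem_setoidClasses.1 hB
      simp only [mem_filter, mem_univ, true_and] at ha hb
      exact r.trans (r.symm ha) hb
  intro r s h
  ext a b
  rw [key r, key s, h]

lemma IsSetPartition.exists_setoidClasses_eq {α : Type*} [Fintype α] {π : Finset (Finset α)}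
    (h : IsSetPartition π univ) : ∃ r : Setoid α, setoidClasses r = π := by
  obtain ⟨-, hne, hdisj, hcov⟩ := h
  have huniq : ∀ {B C : Finset α} {a : α}, B ∈ π → C ∈ π → a ∈ B → a ∈ C → B = C := by
    intro B C a hB hC haB haC
    by_contra hBC
    exact Finset.disjoint_left.1 (hdisj B hB C hC hBC) haB haC
  let r : Setoid α :=
    { r := fun a b => ∃ B ∈ π, a ∈ B ∧ b ∈ B
      iseqv :=
        { refl := fun a => by
            obtain ⟨B, hB, ha⟩ := hcov a (mem_univ a)
            exact ⟨B, hB, ha, ha⟩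
          symm := fun ⟨B, hB, ha, hb⟩ => ⟨B, hB, hb, ha⟩
          trans := fun ⟨B, hB, ha, hb⟩ ⟨C, hC, hb', hc⟩ =>
            ⟨B, hB, ha, huniq hC hB hb' hb ▸ hc⟩ } }
  have hclass : ∀ {B : Finset α} {a : α}, B ∈ π → a ∈ B → (univ.filter fun b => r a b) = B := by
    intro B a hB ha
    ext b
    simp only [mem_filter, mem_univ, true_and]
    exact ⟨fun ⟨C, hC, ha', hb⟩ => huniq hC hB ha' ha ▸ hb, fun hb => ⟨B, hB, ha, hb⟩⟩
  refine ⟨r, ?_⟩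
  ext B
  rw [mem_setoidClasses]
  constructor
  · rintro ⟨a, rfl⟩
    obtain ⟨B, hB, ha⟩ := hcov a (mem_univ a)
    rwa [hclass hB ha]
  · intro hB
    obtain ⟨a, ha⟩ := hne B hB
    exact ⟨a, hclass hB ha⟩

lemma sum_setPartitions_univ {α M : Type*} [Fintype α] [AddCommMonoid M]
    (F : Finset (Finset α) → M) :
    ∑ π ∈ setPartitions (univ : Finset α), F π = ∑ r : Setoid α, F (setoidClasses r) := by
  symm
  refine Finset.sum_bij (fun r _ => setoidClasses r) ?_
    (fun r _ s _ h => setoidClasses_injective h) ?_ fun _ _ => rfl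
  · intro r _
    simpa [setPartitions] using isSetPartition_setoidClasses r
  · intro π hπ
    obtain ⟨r, hr⟩ := IsSetPartition.exists_setoidClasses_eq (Finset.mem_filter.1 hπ).2
    exact ⟨r, mem_univ r, hr⟩

/-! ### Edges inside the classes of an equivalence relation -/

/-- The equivalence relation whose classes are the connected components of `(V, S)`. -/
def componentSetoid {V E : Type*} (ends : E → Sym2 V) (S : Finset E) : Setoid V where
  r := Relation.ReflTransGen fun a b => ∃ e ∈ S, ends e = s(a, b)
  iseqv :=
    { refl := fun _ => Relation.ReflTransGen.refl
      symm := fun h => Relation.ReflTransGen.mono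
        (fun _ _ ⟨e, he, h⟩ => ⟨e, he, h.trans Sym2.eq_swap⟩) _ _ h.swap
      trans := Relation.ReflTransGen.trans }

/-- The edges both of whose endpoints lie in the same class of `r`. -/
def edgesWithin {V E : Type*} [Fintype E] (ends : E → Sym2 V) (r : Setoid V) : Finset E :=
  univ.filter fun e => ∀ v ∈ ends e, ∀ w ∈ ends e, r v w

lemma componentSetoid_le_iff {V E : Type*} [Fintype E] {ends : E → Sym2 V} {S : Finset E}
    {r : Setoid V} : componentSetoid ends S ≤ r ↔ S ⊆ edgesWithin ends r := by
  constructor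
  · intro h e he
    simp only [edgesWithin, mem_filter, mem_univ, true_and]
    generalize hz : ends e = z
    induction z using Sym2.inductionOn with | hf a b => ?_
    have hab : r a b := h (Relation.ReflTransGen.single ⟨e, he, hz⟩)
    intro v hv w hw
    rcases Sym2.mem_iff.1 hv with rfl | rfl <;> rcases Sym2.mem_iff.1 hw with rfl | rfl
    exacts [r.refl _, hab, r.symm hab, r.refl _]
  · intro h a b hab
    change Relation.ReflTransGen _ a b at hab
    induction hab with
    | refl => exact r.refl _
    | tail _ hbc ih =>
      obtain ⟨e, he, hz⟩ := hbc
      have he' := h he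
      simp only [edgesWithin, mem_filter, mem_univ, true_and] at he'
      exact r.trans ih (he' _ (by simp [hz]) _ (by simp [hz]))

lemma card_quotient_componentSetoid_eq_one_iff {V E : Type*} [Fintype V] [Nonempty V]
    {ends : E → Sym2 V} {S : Finset E} :
    Fintype.card (Quotient (componentSetoid ends S)) = 1 ↔ SConnected ends S := by
  rw [Fintype.card_eq_one_iff_nonempty_unique]
  constructor
  · rintro ⟨_⟩ v w
    exact Quotient.exact (s := componentSetoid ends S) (Subsingleton.elim _ _)
  · intro h
    obtain ⟨v⟩ := ‹Nonempty V›
    exact ⟨⟨⟨Quotient.mk _ v⟩, fun x => by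
      induction x using Quotient.inductionOn with | h w => exact Quotient.sound (h w v)⟩⟩

lemma sum_card_edgesIn_setoidClasses {V E : Type*} [Fintype V] [Fintype E] (ends : E → Sym2 V)
    (r : Setoid V) :
    ∑ B ∈ setoidClasses r, (edgesIn ends B).card = (edgesWithin ends r).card := by
  obtain ⟨-, -, hdisj, -⟩ := isSetPartition_setoidClasses r
  rw [← Finset.card_biUnion]
  · congr 1
    ext e
    simp only [mem_biUnion, mem_setoidClasses, edgesIn, edgesWithin, mem_filter, mem_univ,
      true_and]
    constructor
    · rintro ⟨_, ⟨a, rfl⟩, h⟩ v hv w hw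
      have hav := h v hv
      have haw := h w hw
      simp only [mem_filter, mem_univ, true_and] at hav haw
      exact r.trans (r.symm hav) haw
    · intro h
      obtain ⟨v, hv⟩ : ∃ v, v ∈ ends e := ⟨_, Sym2.out_fst_mem _⟩
      exact ⟨_, ⟨v, rfl⟩, fun w hw => by simpa using h v hv w hw⟩
  · intro B hB C hC hne
    rw [Function.onFun, Finset.disjoint_left]
    intro e heB heC
    simp only [edgesIn, mem_filter, mem_univ, true_and] at heB heC
    exact Finset.disjoint_left.1 (hdisj B hB C hC hne) (heB _ (Sym2.out_fst_mem _))
      (heC _ (Sym2.out_fst_mem _))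

lemma prod_pow_card_edgesIn_setoidClasses {V E R : Type*} [Fintype V] [Fintype E] [CommRing R]
    (ends : E → Sym2 V) (r : Setoid V) (q : R) :
    ∏ B ∈ setoidClasses r, q ^ (edgesIn ends B).card =
      ∑ S : Finset E with componentSetoid ends S ≤ r, (q - 1) ^ S.card := by
  rw [Finset.prod_pow_eq_pow_sum, sum_card_edgesIn_setoidClasses]
  have h := Finset.sum_pow_mul_eq_add_pow (q - 1) 1 (edgesWithin ends r)
  simp only [one_pow, mul_one, sub_add_cancel] at h
  rw [← h]
  refine Finset.sum_congr ?_ fun _ _ => rfl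
  ext S
  simp [componentSetoid_le_iff]

/-- **Lemma 3.3.** For a multigraph `G = (V, E)`,
`Σ_{S ⊆ E, (V,S) connected} (q-1)^{#S}
  = Σ_{π ∈ 𝒫(V)} (-1)^{#π-1}(#π-1)! Π_{B∈π} q^{#(E|_B)}`
as polynomials in `q` with integer coefficients. -/
theorem stmt1 {V E : Type*} [Fintype V] [Nonempty V] [Fintype E] (ends : E → Sym2 V) :
    ∑ S ∈ (univ : Finset E).powerset.filter (fun S => SConnected ends S),
        ((Polynomial.X : Polynomial ℤ) - 1) ^ S.card =
      ∑ π ∈ setPartitions (univ : Finset V),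
        (-1 : Polynomial ℤ) ^ (π.card - 1) * ((π.card - 1).factorial : Polynomial ℤ) *
          ∏ B ∈ π, (Polynomial.X : Polynomial ℤ) ^ (edgesIn ends B).card := by
  rw [sum_setPartitions_univ]
  simp only [card_setoidClasses, prod_pow_card_edgesIn_setoidClasses, Finset.mul_sum]
  rw [Finset.sum_comm' (t' := univ) (s' := fun S => univ.filter fun r => componentSetoid ends S ≤ r)
    (by simp), Finset.powerset_univ, Finset.sum_filter]
  refine Finset.sum_congr rfl fun S _ => ?_
  have h := congrArg (Int.cast : ℤ → Polynomial ℤ) (sum_moebius_card_quotient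
    (componentSetoid ends S))
  push_cast at h
  rw [← Finset.sum_mul, h]
  simp [card_quotient_componentSetoid_eq_one_iff]

end
end

section
/- Let G = (V,E) be a multigraph with #V ≥ 2 and let w ∈ V. Write c_H(q) := Σ_{S ⊆ E(H) with spanning subgraph connected} q^{#S} for any multigraph H, let ℓ_w be the number of loops at w, and for B ⊆ V∖{w} let d(B,w) be the number of non-loop edges of G joining w to a vertex of B. Then c_G(q) = (1+q)^{ℓ_w} · Σ_{π ∈ 𝒫(V∖{w})} Π_{B∈π} ((1+q)^{d(B,w)} − 1) · c_{G|_B}(q). (This is the vertex-deletion recursion used to prove Proposition 3.1.) -/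
open Finset

open scoped Classical

noncomputable section

/-! ### Generating functions of families of edge sets -/

/-- The generating function by cardinality of the subsets of `F` satisfying `P`. -/
def subsetGenFun {E : Type*} (F : Finset E) (P : Finset E → Prop) : Polynomial ℤ :=
  ∑ S ∈ F.powerset.filter P, Polynomial.X ^ S.card

theorem subsetGenFun_congr {E : Type*} {F : Finset E} {P Q : Finset E → Prop}
    (h : ∀ S ⊆ F, (P S ↔ Q S)) : subsetGenFun F P = subsetGenFun F Q := by
  refine sum_congr (filter_congr fun S hS => h S (mem_powerset.1 hS)) fun _ _ => rfl

theorem subsetGenFun_true {E : Type*} (F : Finset E) :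
    subsetGenFun F (fun _ => True) = (1 + Polynomial.X) ^ F.card := by
  have h := Finset.sum_pow_mul_eq_add_pow (Polynomial.X : Polynomial ℤ) 1 F
  simpa [subsetGenFun, add_comm] using h

theorem subsetGenFun_nonempty {E : Type*} (F : Finset E) :
    subsetGenFun F (fun S => S.Nonempty) = (1 + Polynomial.X) ^ F.card - 1 := by
  rw [← subsetGenFun_true F, subsetGenFun, subsetGenFun, filter_true]
  trans ∑ S ∈ F.powerset.erase ∅, Polynomial.X ^ S.card
  · refine sum_congr ?_ fun _ _ => rfl
    ext S
    simp only [mem_filter, mem_erase, nonempty_iff_ne_empty, and_comm]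
  · rw [sum_erase_eq_sub (empty_mem_powerset F), card_empty, pow_zero]

/-- The generating function is multiplicative for local conditions on disjoint ground sets. -/
theorem subsetGenFun_union {E : Type*} {F G : Finset E} (hFG : Disjoint F G)
    {P Q R : Finset E → Prop} (hP : ∀ S, P (S ∩ F) ↔ P S) (hQ : ∀ S, Q (S ∩ G) ↔ Q S)
    (hR : ∀ S, R S ↔ P S ∧ Q S) :
    subsetGenFun (F ∪ G) R = subsetGenFun F P * subsetGenFun G Q := by
  unfold subsetGenFun
  rw [sum_mul_sum, ← sum_product']
  have hl : ∀ S T, S ⊆ F → T ⊆ G → (S ∪ T) ∩ F = S := by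
    intro S T hS hT
    rw [union_inter_distrib_right, inter_eq_left.2 hS,
      disjoint_iff_inter_eq_empty.1 ((hFG.mono_right hT).symm), union_empty]
  have hr : ∀ S T, S ⊆ F → T ⊆ G → (S ∪ T) ∩ G = T := by
    intro S T hS hT
    rw [union_inter_distrib_right, inter_eq_left.2 hT,
      disjoint_iff_inter_eq_empty.1 (hFG.mono_left hS), empty_union]
  have hu : ∀ S ⊆ F ∪ G, S ∩ F ∪ S ∩ G = S := by
    intro S hS
    rw [← inter_union_distrib_left, inter_eq_left.2 hS]
  refine sum_nbij' (fun S => (S ∩ F, S ∩ G)) (fun p => p.1 ∪ p.2) ?_ ?_ ?_ ?_ ?_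
  · intro S hS
    simp only [mem_filter, mem_powerset, mem_product, hR] at hS ⊢
    exact ⟨⟨inter_subset_right, (hP S).2 hS.2.1⟩, inter_subset_right, (hQ S).2 hS.2.2⟩
  · rintro ⟨S, T⟩ h
    simp only [mem_filter, mem_powerset, mem_product, hR] at h ⊢
    refine ⟨union_subset_union h.1.1 h.2.1, ?_, ?_⟩
    · rw [← hP, hl S T h.1.1 h.2.1]
      exact h.1.2
    · rw [← hQ, hr S T h.1.1 h.2.1]
      exact h.2.2
  · intro S hS
    exact hu S (mem_powerset.1 (mem_filter.1 hS).1)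
  · rintro ⟨S, T⟩ h
    simp only [mem_filter, mem_powerset, mem_product] at h
    simp only [hl S T h.1.1 h.2.1, hr S T h.1.1 h.2.1]
  · intro S hS
    have h := hu S (mem_powerset.1 (mem_filter.1 hS).1)
    rw [← pow_add, ← card_union_of_disjoint
      (hFG.mono inter_subset_right inter_subset_right), h]

theorem forall_mem_inter_biUnion_iff {E ι : Type*} {π : Finset ι} {F : ι → Finset E}
    {P : ι → Finset E → Prop} (hP : ∀ B S, P B (S ∩ F B) ↔ P B S) (S : Finset E) :
    (∀ B ∈ π, P B (S ∩ π.biUnion F)) ↔ ∀ B ∈ π, P B S := by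
  refine forall₂_congr fun B hB => ?_
  rw [← hP B (S ∩ π.biUnion F), inter_assoc, inter_eq_right.2 (subset_biUnion_of_mem F hB), hP]

theorem subsetGenFun_biUnion {E ι : Type*} (π : Finset ι) {F : ι → Finset E}
    (hF : ∀ B ∈ π, ∀ C ∈ π, B ≠ C → Disjoint (F B) (F C))
    {P : ι → Finset E → Prop} (hP : ∀ B S, P B (S ∩ F B) ↔ P B S) :
    subsetGenFun (π.biUnion F) (fun S => ∀ B ∈ π, P B S) = ∏ B ∈ π, subsetGenFun (F B) (P B) := by
  induction π using Finset.induction_on with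
  | empty => simp [subsetGenFun]
  | insert B π hB ih =>
    rw [prod_insert hB, biUnion_insert, ← ih fun C hC D hD =>
        hF C (mem_insert_of_mem hC) D (mem_insert_of_mem hD),
      subsetGenFun_union ?_ (hP B) (forall_mem_inter_biUnion_iff hP)
        fun S => forall_mem_insert B π (P · S)]
    · refine (disjoint_biUnion_right _ _ _).2 fun C hC => ?_
      refine hF B (mem_insert_self _ _) C (mem_insert_of_mem hC) ?_
      rintro rfl
      exact hB hC

/-! ### Edges near a vertex -/

/-- The edges joining `w` to some vertex of `B`. -/
def edgesTo {V E : Type*} [Fintype E] (ends : E → Sym2 V) (B : Finset V) (w : V) : Finset E :=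
  univ.filter fun e => ∃ b ∈ B, ends e = s(w, b)

/-- The edges with both endpoints in `B`, together with those joining `w` to `B`. -/
def blockEdges {V E : Type*} [Fintype E] (ends : E → Sym2 V) (w : V) (B : Finset V) : Finset E :=
  edgesIn ends B ∪ edgesTo ends B w

/-- The loops at `w`. -/
def loopsAt {V E : Type*} [Fintype E] (ends : E → Sym2 V) (w : V) : Finset E :=
  univ.filter fun e => ends e = s(w, w)

/-- `S` connects `B` by edges inside `B`, and contains an edge from `w` to `B`. -/
def IsAttached {V E : Type*} [Fintype E] (ends : E → Sym2 V) (w : V) (B : Finset V)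
    (S : Finset E) : Prop :=
  SConnectedOn ends B (S ∩ edgesIn ends B) ∧ (S ∩ edgesTo ends B w).Nonempty

section

variable {V E : Type*} [Fintype E] {ends : E → Sym2 V} {w : V}

theorem mem_edgesIn_iff {B : Finset V} {e : E} {a b : V} (h : ends e = s(a, b)) :
    e ∈ edgesIn ends B ↔ a ∈ B ∧ b ∈ B := by
  simp [edgesIn, h]

theorem mem_edgesTo_iff {B : Finset V} {e : E} :
    e ∈ edgesTo ends B w ↔ ∃ b ∈ B, ends e = s(w, b) := by
  simp [edgesTo]

theorem disjoint_edgesIn_edgesTo {B C : Finset V} (hB : w ∉ B) :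
    Disjoint (edgesIn ends B) (edgesTo ends C w) := by
  rw [disjoint_left]
  intro e he he'
  obtain ⟨b, -, h⟩ := mem_edgesTo_iff.1 he'
  exact hB ((mem_edgesIn_iff h).1 he).1

theorem disjoint_edgesIn {B C : Finset V} (h : Disjoint B C) :
    Disjoint (edgesIn ends B) (edgesIn ends C) := by
  rw [disjoint_left]
  intro e he he'
  obtain ⟨a, b, hab⟩ : ∃ a b, ends e = s(a, b) :=
    (ends e).inductionOn fun a b => ⟨a, b, rfl⟩
  exact disjoint_left.1 h ((mem_edgesIn_iff hab).1 he).1 ((mem_edgesIn_iff hab).1 he').1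

theorem disjoint_edgesTo {B C : Finset V} (h : Disjoint B C) :
    Disjoint (edgesTo ends B w) (edgesTo ends C w) := by
  rw [disjoint_left]
  intro e he he'
  obtain ⟨b, hb, h₁⟩ := mem_edgesTo_iff.1 he
  obtain ⟨c, hc, h₂⟩ := mem_edgesTo_iff.1 he'
  obtain rfl : b = c := Sym2.congr_right.1 (h₁.symm.trans h₂)
  exact disjoint_left.1 h hb hc

theorem disjoint_blockEdges {B C : Finset V} (hB : w ∉ B) (hC : w ∉ C) (h : Disjoint B C) :
    Disjoint (blockEdges ends w B) (blockEdges ends w C) := by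
  rw [blockEdges, blockEdges, disjoint_union_left, disjoint_union_right, disjoint_union_right]
  exact ⟨⟨disjoint_edgesIn h, disjoint_edgesIn_edgesTo hB⟩,
    (disjoint_edgesIn_edgesTo hC).symm, disjoint_edgesTo h⟩

theorem disjoint_loopsAt_blockEdges {B : Finset V} (hB : w ∉ B) :
    Disjoint (loopsAt ends w) (blockEdges ends w B) := by
  rw [disjoint_left]
  intro e he he'
  have hw : ends e = s(w, w) := by simpa [loopsAt] using he
  rcases mem_union.1 he' with he' | he'
  · exact hB ((mem_edgesIn_iff hw).1 he').1
  · obtain ⟨b, hb, h⟩ := mem_edgesTo_iff.1 he'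
    obtain rfl : b = w := Sym2.congr_right.1 (h.symm.trans hw)
    exact hB hb

theorem isAttached_inter_blockEdges (B : Finset V) (S : Finset E) :
    IsAttached ends w B (S ∩ blockEdges ends w B) ↔ IsAttached ends w B S := by
  unfold IsAttached blockEdges
  rw [inter_assoc, inter_assoc, inter_eq_right.2 subset_union_left,
    inter_eq_right.2 subset_union_right]

theorem subsetGenFun_isAttached {B : Finset V} (hB : w ∉ B) :
    subsetGenFun (blockEdges ends w B) (IsAttached ends w B) =
      ((1 + Polynomial.X) ^ dCnt ends B w - 1) * connPoly ends B := by
  have h := subsetGenFun_union (disjoint_edgesIn_edgesTo (ends := ends) (C := B) hB)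
    (P := fun S => SConnectedOn ends B (S ∩ edgesIn ends B))
    (Q := fun S => (S ∩ edgesTo ends B w).Nonempty)
    (fun S => by rw [inter_assoc, inter_self]) (fun S => by rw [inter_assoc, inter_self])
    (fun _ => Iff.rfl)
  refine h.trans ?_
  rw [mul_comm]
  congr 1
  · rw [← show (edgesTo ends B w).card = dCnt ends B w from rfl, ← subsetGenFun_nonempty]
    exact subsetGenFun_congr fun S hS => by rw [inter_eq_left.2 hS]
  · exact subsetGenFun_congr fun S hS => by rw [inter_eq_left.2 hS]

end

/-! ### Components after deleting a vertex -/

/-- Reachability along edges of `S` avoiding the vertex `w`. -/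
def ReachAvoiding {V E : Type*} (ends : E → Sym2 V) (w : V) (S : Finset E) : V → V → Prop :=
  Relation.ReflTransGen fun a b => a ≠ w ∧ b ≠ w ∧ ∃ e ∈ S, ends e = s(a, b)

/-- The vertices other than `w` reachable from `a` along edges of `S` avoiding `w`. -/
def deletedComponent {V E : Type*} [Fintype V] (ends : E → Sym2 V) (w : V) (S : Finset E)
    (a : V) : Finset V :=
  (univ.erase w).filter (ReachAvoiding ends w S a)

/-- The vertex sets of the components of `(V, S)` with the vertex `w` deleted. -/
def deletedComponents {V E : Type*} [Fintype V] (ends : E → Sym2 V) (w : V) (S : Finset E) :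
    Finset (Finset V) :=
  (univ.erase w).image (deletedComponent ends w S)

section

variable {V E : Type*} {ends : E → Sym2 V} {w : V} {S : Finset E}

theorem ReachAvoiding.symm {a b : V} (h : ReachAvoiding ends w S a b) :
    ReachAvoiding ends w S b a := by
  refine (@Relation.ReflTransGen.stdSymm _ _ ⟨?_⟩).symm _ _ h
  rintro a b ⟨ha, hb, e, he, h⟩
  exact ⟨hb, ha, e, he, h.trans Sym2.eq_swap⟩

theorem reflTransGen_edge_symm {a b : V}
    (h : Relation.ReflTransGen (fun a b => ∃ e ∈ S, ends e = s(a, b)) a b) :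
    Relation.ReflTransGen (fun a b => ∃ e ∈ S, ends e = s(a, b)) b a := by
  refine (@Relation.ReflTransGen.stdSymm _ _ ⟨?_⟩).symm _ _ h
  rintro a b ⟨e, he, h⟩
  exact ⟨e, he, h.trans Sym2.eq_swap⟩

variable [Fintype V]

theorem mem_deletedComponent {a b : V} :
    b ∈ deletedComponent ends w S a ↔ b ≠ w ∧ ReachAvoiding ends w S a b := by
  simp [deletedComponent]

theorem deletedComponent_eq {a b : V} (h : ReachAvoiding ends w S a b) :
    deletedComponent ends w S a = deletedComponent ends w S b := by
  ext c
  simp only [mem_deletedComponent]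
  exact and_congr_right fun _ => ⟨fun hc => h.symm.trans hc, fun hc => h.trans hc⟩

theorem deletedComponents_mem_setPartitions :
    deletedComponents ends w S ∈ setPartitions ((univ : Finset V).erase w) := by
  have hsub : ∀ B ∈ deletedComponents ends w S, B ⊆ univ.erase w := by
    intro B hB
    obtain ⟨a, -, rfl⟩ := mem_image.1 hB
    exact filter_subset _ _
  refine mem_filter.2 ⟨mem_powerset.2 fun B hB => mem_powerset.2 (hsub B hB), hsub, ?_, ?_, ?_⟩
  · intro B hB
    obtain ⟨a, ha, rfl⟩ := mem_image.1 hB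
    exact ⟨a, mem_deletedComponent.2 ⟨ne_of_mem_erase ha, Relation.ReflTransGen.refl⟩⟩
  · intro B hB C hC hne
    obtain ⟨a, ha, rfl⟩ := mem_image.1 hB
    obtain ⟨b, hb, rfl⟩ := mem_image.1 hC
    rw [disjoint_left]
    intro c hc hc'
    exact hne ((deletedComponent_eq (mem_deletedComponent.1 hc).2).trans
      (deletedComponent_eq (mem_deletedComponent.1 hc').2).symm)
  · intro a ha
    exact ⟨_, mem_image_of_mem _ ha,
      mem_deletedComponent.2 ⟨ne_of_mem_erase ha, Relation.ReflTransGen.refl⟩⟩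

variable [Fintype E]

theorem sConnectedOn_deletedComponent (c : V) :
    SConnectedOn ends (deletedComponent ends w S c)
      (S ∩ edgesIn ends (deletedComponent ends w S c)) := by
  intro a ha b hb
  have hab : ReachAvoiding ends w S a b :=
    (mem_deletedComponent.1 ha).2.symm.trans (mem_deletedComponent.1 hb).2
  clear hb
  induction hab with
  | refl => exact Relation.ReflTransGen.refl
  | tail hax hxy ih =>
    obtain ⟨hx, hy, e, he, h⟩ := hxy
    have hcx := (mem_deletedComponent.1 ha).2.trans hax
    refine ih.tail ⟨e, mem_inter.2 ⟨he, (mem_edgesIn_iff h).2 ⟨?_, ?_⟩⟩, h⟩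
    · exact mem_deletedComponent.2 ⟨hx, hcx⟩
    · exact mem_deletedComponent.2 ⟨hy, hcx.tail ⟨hx, hy, e, he, h⟩⟩

theorem nonempty_inter_edgesTo_deletedComponent (hS : SConnectedOn ends univ S) {a : V}
    (ha : a ≠ w) : (S ∩ edgesTo ends (deletedComponent ends w S a) w).Nonempty := by
  have key : ∀ x, Relation.ReflTransGen (fun a b => ∃ e ∈ S, ends e = s(a, b)) a x →
      (x ≠ w ∧ ReachAvoiding ends w S a x) ∨
        (S ∩ edgesTo ends (deletedComponent ends w S a) w).Nonempty := by
    intro x hx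
    induction hx with
    | refl => exact Or.inl ⟨ha, Relation.ReflTransGen.refl⟩
    | @tail x y _ hxy ih =>
      obtain ⟨e, he, h⟩ := hxy
      rcases ih with ⟨hxw, hax⟩ | ih
      · by_cases hy : y = w
        · subst hy
          exact Or.inr ⟨e, mem_inter.2 ⟨he, mem_edgesTo_iff.2
            ⟨x, mem_deletedComponent.2 ⟨hxw, hax⟩, h.trans Sym2.eq_swap⟩⟩⟩
        · exact Or.inl ⟨hy, hax.tail ⟨hxw, hy, e, he, h⟩⟩
      · exact Or.inr ih
  exact (key w (hS a (mem_univ _) w (mem_univ _))).resolve_left fun h => h.1 rfl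

theorem subset_loopsAt_union_biUnion_blockEdges :
    S ⊆ loopsAt ends w ∪ (deletedComponents ends w S).biUnion (blockEdges ends w) := by
  have hself : ∀ a, a ≠ w → a ∈ deletedComponent ends w S a := fun a ha =>
    mem_deletedComponent.2 ⟨ha, Relation.ReflTransGen.refl⟩
  have hmem : ∀ a, a ≠ w → deletedComponent ends w S a ∈ deletedComponents ends w S :=
    fun a ha => mem_image_of_mem _ (mem_erase.2 ⟨ha, mem_univ _⟩)
  intro e he
  obtain ⟨a, b, h⟩ : ∃ a b, ends e = s(a, b) :=
    (ends e).inductionOn fun a b => ⟨a, b, rfl⟩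
  rw [mem_union, mem_biUnion]
  by_cases ha : a = w
  · subst ha
    by_cases hb : b = a
    · subst hb
      exact Or.inl (by simp [loopsAt, h])
    · exact Or.inr ⟨_, hmem b hb, mem_union_right _ (mem_edgesTo_iff.2 ⟨b, hself b hb, h⟩)⟩
  · refine Or.inr ⟨_, hmem a ha, ?_⟩
    by_cases hb : b = w
    · subst hb
      exact mem_union_right _ (mem_edgesTo_iff.2 ⟨a, hself a ha, h.trans Sym2.eq_swap⟩)
    · exact mem_union_left _ ((mem_edgesIn_iff h).2 ⟨hself a ha, mem_deletedComponent.2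
        ⟨hb, Relation.ReflTransGen.single ⟨ha, hb, e, he, h⟩⟩⟩)

theorem sConnectedOn_univ_of_isAttached {π : Finset (Finset V)}
    (hπ : IsSetPartition π (univ.erase w)) (hS : ∀ B ∈ π, IsAttached ends w B S) :
    SConnectedOn ends univ S := by
  have hw : ∀ a, Relation.ReflTransGen (fun a b => ∃ e ∈ S, ends e = s(a, b)) a w := by
    intro a
    by_cases ha : a = w
    · rw [ha]
    obtain ⟨B, hB, haB⟩ := hπ.2.2.2 a (mem_erase.2 ⟨ha, mem_univ _⟩)
    obtain ⟨hconn, e, he⟩ := hS B hB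
    obtain ⟨b, hb, h⟩ := mem_edgesTo_iff.1 (mem_inter.1 he).2
    refine Relation.ReflTransGen.tail (Relation.ReflTransGen.mono ?_ _ _ (hconn a haB b hb))
      ⟨e, (mem_inter.1 he).1, h.trans Sym2.eq_swap⟩
    rintro x y ⟨f, hf, h⟩
    exact ⟨f, (mem_inter.1 hf).1, h⟩
  exact fun a _ b _ => (hw a).trans (reflTransGen_edge_symm (hw b))

theorem eq_deletedComponent_of_mem {π : Finset (Finset V)}
    (hπ : IsSetPartition π (univ.erase w))
    (hsub : S ⊆ loopsAt ends w ∪ π.biUnion (blockEdges ends w))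
    (hS : ∀ B ∈ π, IsAttached ends w B S) {B : Finset V} (hB : B ∈ π) {a : V} (ha : a ∈ B) :
    B = deletedComponent ends w S a := by
  obtain ⟨hsubset, -, hdisj, -⟩ := hπ
  have hne : ∀ C ∈ π, ∀ c ∈ C, c ≠ w := fun C hC c hc => ne_of_mem_erase (hsubset C hC hc)
  ext b
  rw [mem_deletedComponent]
  constructor
  · intro hb
    refine ⟨hne B hB b hb, Relation.ReflTransGen.mono ?_ _ _ ((hS B hB).1 a ha b hb)⟩
    rintro x y ⟨e, he, h⟩
    have hxy := (mem_edgesIn_iff h).1 (mem_inter.1 he).2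
    exact ⟨hne B hB x hxy.1, hne B hB y hxy.2, e, (mem_inter.1 he).1, h⟩
  · rintro ⟨-, hab⟩
    induction hab with
    | refl => exact ha
    | @tail x y _ hxy hx =>
      obtain ⟨hxw, hyw, e, he, h⟩ := hxy
      rcases mem_union.1 (hsub he) with hl | hb
      · have hl' : ends e = s(w, w) := by simpa [loopsAt] using hl
        rw [h, Sym2.eq_iff] at hl'
        grind
      · obtain ⟨C, hC, heC⟩ := mem_biUnion.1 hb
        rcases mem_union.1 heC with heC | heC
        · have hxy := (mem_edgesIn_iff h).1 heC
          by_cases hBC : B = C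
          · rw [hBC]
            exact hxy.2
          · exact (disjoint_left.1 (hdisj B hB C hC hBC) hx hxy.1).elim
        · obtain ⟨c, -, hc⟩ := mem_edgesTo_iff.1 heC
          rw [h, Sym2.eq_iff] at hc
          grind

theorem deletedComponents_eq {π : Finset (Finset V)}
    (hπ : IsSetPartition π (univ.erase w))
    (hsub : S ⊆ loopsAt ends w ∪ π.biUnion (blockEdges ends w))
    (hS : ∀ B ∈ π, IsAttached ends w B S) : deletedComponents ends w S = π := by
  ext B
  constructor
  · intro hB
    obtain ⟨a, ha, rfl⟩ := mem_image.1 hB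
    obtain ⟨C, hC, haC⟩ := hπ.2.2.2 a ha
    rwa [← eq_deletedComponent_of_mem hπ hsub hS hC haC]
  · intro hB
    obtain ⟨a, ha⟩ := hπ.2.1 B hB
    rw [eq_deletedComponent_of_mem hπ hsub hS hB ha]
    exact mem_image_of_mem _ (hπ.1 B hB ha)

/-- The connected edge sets whose components after deletion of `w` form the partition `π`
are those attaching every block of `π` to `w` and using no edge between distinct blocks. -/
theorem sConnectedOn_univ_and_deletedComponents_eq_iff {π : Finset (Finset V)}
    (hπ : IsSetPartition π (univ.erase w)) :
    SConnectedOn ends univ S ∧ deletedComponents ends w S = π ↔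
      S ⊆ loopsAt ends w ∪ π.biUnion (blockEdges ends w) ∧ ∀ B ∈ π, IsAttached ends w B S := by
  constructor
  · rintro ⟨hS, rfl⟩
    refine ⟨subset_loopsAt_union_biUnion_blockEdges, fun B hB => ?_⟩
    obtain ⟨a, ha, rfl⟩ := mem_image.1 hB
    exact ⟨sConnectedOn_deletedComponent a,
      nonempty_inter_edgesTo_deletedComponent hS (ne_of_mem_erase ha)⟩
  · rintro ⟨hsub, hS⟩
    exact ⟨sConnectedOn_univ_of_isAttached hπ hS, deletedComponents_eq hπ hsub hS⟩

theorem subsetGenFun_loopsAt_union_biUnion_blockEdges {π : Finset (Finset V)}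
    (hπ : IsSetPartition π (univ.erase w)) :
    subsetGenFun (loopsAt ends w ∪ π.biUnion (blockEdges ends w))
        (fun S => ∀ B ∈ π, IsAttached ends w B S) =
      (1 + Polynomial.X) ^ eCnt ends w w *
        ∏ B ∈ π, ((1 + Polynomial.X) ^ dCnt ends B w - 1) * connPoly ends B := by
  have hw : ∀ B ∈ π, w ∉ B := fun B hB h => notMem_erase w _ (hπ.1 B hB h)
  rw [← prod_congr rfl fun B hB => subsetGenFun_isAttached (hw B hB),
    ← subsetGenFun_biUnion π (fun B hB C hC hne =>
      disjoint_blockEdges (hw B hB) (hw C hC) (hπ.2.2.1 B hB C hC hne)) isAttached_inter_blockEdges,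
    ← show (loopsAt ends w).card = eCnt ends w w from rfl, ← subsetGenFun_true,
    subsetGenFun_union (P := fun _ => True) (Q := fun S => ∀ B ∈ π, IsAttached ends w B S) ?_
      (fun _ => Iff.rfl) (forall_mem_inter_biUnion_iff isAttached_inter_blockEdges)
      fun _ => (true_and _).to_iff.symm]
  exact (disjoint_biUnion_right _ _ _).2 fun B hB => disjoint_loopsAt_blockEdges (hw B hB)

end

/-- **Vertex-deletion recursion** for the generating function of connected spanning
subgraphs: for a multigraph `G` with at least two vertices and a vertex `w`,
`c_G(q) = (1+q)^{ℓ_w} Σ_{π ∈ 𝒫(V∖{w})} Π_{B∈π} ((1+q)^{d(B,w)} - 1) c_{G|_B}(q)`. -/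
theorem stmt3 {V E : Type*} [Fintype V] [Fintype E] (ends : E → Sym2 V)
    (hV : 2 ≤ Fintype.card V) (w : V) :
    connPoly ends (univ : Finset V) =
      (1 + (Polynomial.X : Polynomial ℤ)) ^ eCnt ends w w *
        ∑ π ∈ setPartitions ((univ : Finset V).erase w),
          ∏ B ∈ π,
            ((1 + (Polynomial.X : Polynomial ℤ)) ^ dCnt ends B w - 1) * connPoly ends B := by
  rw [mul_sum, connPoly, ← sum_fiberwise_of_maps_to
    fun S _ => deletedComponents_mem_setPartitions (ends := ends) (w := w) (S := S)]
  refine sum_congr rfl fun π hπ => ?_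
  have hπ' := (mem_filter.1 hπ).2
  rw [← subsetGenFun_loopsAt_union_biUnion_blockEdges hπ', subsetGenFun]
  refine sum_congr ?_ fun _ _ => rfl
  ext S
  have huniv : S ⊆ edgesIn ends univ := fun e _ => by simp [edgesIn]
  simp only [mem_filter, mem_powerset, huniv, true_and]
  exact sConnectedOn_univ_and_deletedComponents_eq_iff hπ'

end
end

section
/- (Proposition 3.1.) Let G be a multigraph with vertex set [r] = {1,…,r}, rooted at v = 1. Then 𝓘_G(q) = q^{ℓ(G)} · Σ_T Π_{w ∈ [r]∖{1}} [δ_T(w)]_q, where the sum runs over all spanning trees T of G̃ having no κ-inversion, and ℓ(G) is the number of loops of G. -/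
open Finset

open scoped Classical

noncomputable section

/-! ### Reachability along a self-map -/

/-- Some iterate of `p` sends `u` to `w`. -/
def Reaches {V : Type*} (p : V → V) (u w : V) : Prop := ∃ k, p^[k] u = w

namespace Reaches

variable {V : Type*} {p p' : V → V} {u v w : V}

theorem refl (p : V → V) (u : V) : Reaches p u u := ⟨0, rfl⟩

theorem head (h : Reaches p (p u) w) : Reaches p u w := by
  obtain ⟨k, hk⟩ := h
  exact ⟨k + 1, hk⟩

theorem tail_of_ne (h : Reaches p u w) (hne : u ≠ w) : Reaches p (p u) w := by
  obtain ⟨k, hk⟩ := h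
  cases k with
  | zero => exact absurd hk hne
  | succ k => exact ⟨k, hk⟩

theorem head_induction {P : V → Prop} (h : Reaches p u w) (base : P w)
    (step : ∀ x, x ≠ w → Reaches p (p x) w → P (p x) → P x) : P u := by
  obtain ⟨k, hk⟩ := h
  induction k generalizing u with
  | zero =>
    obtain rfl : u = w := hk
    exact base
  | succ k ih =>
    by_cases hu : u = w
    · exact hu ▸ base
    · exact step u hu ⟨k, hk⟩ (ih hk)

theorem invariant {P : V → Prop} (h : Reaches p u w) (hP : ∀ x, P x → P (p x)) (hu : P u) :
    P w := by
  obtain ⟨k, hk⟩ := h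
  induction k generalizing u with
  | zero =>
    obtain rfl : u = w := hk
    exact hu
  | succ k ih => exact ih (hP _ hu) hk

theorem trans (h : Reaches p u v) (h' : Reaches p v w) : Reaches p u w :=
  h.head_induction (P := fun x => Reaches p x w) h' fun _ _ _ hx => hx.head

theorem eq_of_fixed (h : Reaches p u w) (hu : p u = u) : u = w :=
  (h.invariant (P := fun x => x = u) (fun x hx => by rw [hx, hu]) rfl).symm

theorem congr_on {A : Set V} (h : Reaches p u w) (hu : u ∈ A)
    (hA : ∀ x ∈ A, x ≠ w → p x = p' x ∧ p x ∈ A) : Reaches p' u w := by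
  have key : u ∈ A → Reaches p' u w := by
    refine h.head_induction (P := fun x => x ∈ A → Reaches p' x w) (fun _ => refl _ _) ?_
    intro x hx _ ih hxA
    obtain ⟨h1, h2⟩ := hA x hxA hx
    exact head (h1 ▸ ih h2)
  exact key hu

theorem total (h : Reaches p u v) (huw : Reaches p u w) : Reaches p v w ∨ Reaches p w v := by
  have key : Reaches p u w → Reaches p v w ∨ Reaches p w v := by
    refine h.head_induction (P := fun x => Reaches p x w → Reaches p v w ∨ Reaches p w v)
      Or.inl ?_
    intro x hx hxv ih hxw
    by_cases hw : x = w
    · exact Or.inr (hw ▸ hxv.head)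
    · exact ih (hxw.tail_of_ne hw)
  exact key huw

/-- A point of a cycle can only reach points that reach it back. -/
theorem of_cycle (hcyc : Reaches p (p w) w) (h : Reaches p w v) : Reaches p v w := by
  refine h.invariant (P := fun x => Reaches p x w) (fun x hx => ?_) (refl _ _)
  by_cases hxw : x = w
  · exact hxw ▸ hcyc
  · exact hx.tail_of_ne hxw

end Reaches

/-! ### Sums over rooted trees -/

section Graft

variable {V : Type*} [DecidableEq V]

/-- The map equal to `p` on `A` and to the identity elsewhere. -/
def restrictMap (p : V → V) (A : Finset V) (u : V) : V := if u ∈ A then p u else u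

/-- The parent map obtained from trees `p₁` on `C` rooted at `w` and `p₂` outside `C` by
attaching `w` to `v`. -/
def graft (v w : V) (C : Finset V) (p₁ p₂ : V → V) (u : V) : V :=
  if u = w then v else if u ∈ C then p₁ u else p₂ u

variable {v w : V} {C : Finset V} {p₁ p₂ : V → V}

theorem graft_self : graft v w C p₁ p₂ w = v := if_pos rfl

theorem graft_of_mem {u : V} (hu : u ∈ C.erase w) : graft v w C p₁ p₂ u = p₁ u := by
  rw [mem_erase] at hu
  simp [graft, hu]

theorem graft_of_notMem (hwC : w ∈ C) {u : V} (hu : u ∉ C) : graft v w C p₁ p₂ u = p₂ u := by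
  simp [graft, hu, (ne_of_mem_of_not_mem hwC hu).symm]

end Graft

section Trees

variable {V : Type*} [Fintype V]

/-- The points that reach `w` along `p`. -/
def subtreeAt (p : V → V) (w : V) : Finset V := univ.filter fun u => ∃ k, p^[k] u = w

theorem mem_subtreeAt {p : V → V} {u w : V} : u ∈ subtreeAt p w ↔ Reaches p u w := by
  simp [subtreeAt, Reaches]

variable [DecidableEq V]

/-- The trees with vertex set `insert v S` and root `v`, encoded by parent maps fixing every
point outside `S`. -/
def rootedTrees (v : V) (S : Finset V) : Finset (V → V) :=
  univ.filter fun p => (∀ u, u ∉ S → p u = u) ∧ ∀ u ∈ S, Reaches p u v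

theorem mem_rootedTrees {v : V} {S : Finset V} {p : V → V} :
    p ∈ rootedTrees v S ↔ (∀ u, u ∉ S → p u = u) ∧ ∀ u ∈ S, Reaches p u v := by
  simp [rootedTrees]

theorem parent_mem {v : V} {S : Finset V} {p : V → V} (hv : v ∉ S) (hp : p ∈ rootedTrees v S)
    {u : V} (hu : u ∈ S) : p u ∈ insert v S := by
  rw [mem_rootedTrees] at hp
  by_contra h
  rw [mem_insert, not_or] at h
  have h1 : Reaches p (p u) v := (hp.2 u hu).tail_of_ne (ne_of_mem_of_not_mem hu hv)
  exact h.1 (h1.eq_of_fixed (hp.1 _ h.2))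

theorem subtreeAt_subset {v : V} {S : Finset V} {p : V → V} (hp : p ∈ rootedTrees v S)
    {w : V} (hw : w ∈ S) : subtreeAt p w ⊆ S := by
  intro u hu
  by_contra h
  exact h ((mem_subtreeAt.1 hu).eq_of_fixed ((mem_rootedTrees.1 hp).1 u h) ▸ hw)

theorem restrictMap_erase_mem {w : V} {C : Finset V} {p : V → V}
    (hwC : w ∈ C) (hC : subtreeAt p w = C) :
    restrictMap p (C.erase w) ∈ rootedTrees w (C.erase w) := by
  subst hC
  rw [mem_rootedTrees]
  refine ⟨fun u hu => if_neg hu, fun u hu => ?_⟩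
  refine (mem_subtreeAt.1 (mem_of_mem_erase hu)).congr_on (A := subtreeAt p w)
    (mem_of_mem_erase hu) fun x hx hxw => ?_
  have hx' : x ∈ subtreeAt p w := hx
  refine ⟨(if_pos (mem_erase.2 ⟨hxw, hx'⟩)).symm, ?_⟩
  exact mem_subtreeAt.2 ((mem_subtreeAt.1 hx').tail_of_ne hxw)

theorem restrictMap_sdiff_mem {v w : V} {S C : Finset V} {p : V → V} (hv : v ∉ S)
    (hp : p ∈ rootedTrees v S) (hC : subtreeAt p w = C) :
    restrictMap p (S \ C) ∈ rootedTrees v (S \ C) := by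
  subst hC
  rw [mem_rootedTrees]
  refine ⟨fun u hu => if_neg hu, fun u hu => ?_⟩
  refine ((mem_rootedTrees.1 hp).2 u (mem_sdiff.1 hu).1).congr_on
    (A := insert v (S \ subtreeAt p w : Finset V)) (Or.inr hu) fun x hx hxv => ?_
  have hx' : x ∈ S \ subtreeAt p w := hx.resolve_left hxv
  refine ⟨(if_pos hx').symm, ?_⟩
  rw [mem_sdiff, mem_subtreeAt] at hx'
  rcases mem_insert.1 (parent_mem hv hp hx'.1) with h | h
  · exact Or.inl h
  · exact Or.inr (mem_coe.2 (mem_sdiff.2 ⟨h, fun h' => hx'.2 (mem_subtreeAt.1 h').head⟩))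

section Graft

variable {v w : V} {S C : Finset V} {p₁ p₂ : V → V}

theorem mem_of_parent_mem_erase (hwC : w ∈ C) (h₁ : p₁ ∈ rootedTrees w (C.erase w))
    {u : V} (hu : u ∈ C.erase w) : p₁ u ∈ C := by
  have := parent_mem (notMem_erase w C) h₁ hu
  rwa [insert_erase hwC] at this

theorem parent_notMem_of_notMem (hv : v ∉ S) (hCS : C ⊆ S) (h₂ : p₂ ∈ rootedTrees v (S \ C))
    {u : V} (hu : u ∉ C) : p₂ u ∉ C := by
  by_cases huS : u ∈ S
  · have := parent_mem (fun h => hv (mem_sdiff.1 h).1) h₂ (mem_sdiff.2 ⟨huS, hu⟩)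
    rcases mem_insert.1 this with h | h
    · exact h ▸ fun h' => hv (hCS h')
    · exact (mem_sdiff.1 h).2
  · rw [(mem_rootedTrees.1 h₂).1 u fun h => huS (mem_sdiff.1 h).1]
    exact hu

theorem subtreeAt_graft_self (hv : v ∉ S) (hCS : C ⊆ S) (hwC : w ∈ C)
    (h₁ : p₁ ∈ rootedTrees w (C.erase w)) (h₂ : p₂ ∈ rootedTrees v (S \ C)) :
    subtreeAt (graft v w C p₁ p₂) w = C := by
  ext u
  rw [mem_subtreeAt]
  constructor
  · intro h
    refine h.head_induction (P := fun x => x ∈ C) hwC fun x _ _ ih => ?_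
    by_contra hx
    rw [graft_of_notMem hwC hx] at ih
    exact parent_notMem_of_notMem hv hCS h₂ hx ih
  · intro hu
    by_cases huw : u = w
    · exact huw ▸ Reaches.refl _ _
    refine ((mem_rootedTrees.1 h₁).2 u (mem_erase.2 ⟨huw, hu⟩)).congr_on (A := C) hu
      fun x hx hxw => ?_
    have hx' : x ∈ C.erase w := mem_erase.2 ⟨hxw, hx⟩
    exact ⟨(graft_of_mem hx').symm, mem_of_parent_mem_erase hwC h₁ hx'⟩

theorem graft_mem (hv : v ∉ S) (hCS : C ⊆ S) (hwC : w ∈ C)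
    (h₁ : p₁ ∈ rootedTrees w (C.erase w)) (h₂ : p₂ ∈ rootedTrees v (S \ C)) :
    graft v w C p₁ p₂ ∈ rootedTrees v S := by
  rw [mem_rootedTrees]
  refine ⟨fun u hu => ?_, fun u hu => ?_⟩
  · rw [graft_of_notMem hwC fun h => hu (hCS h)]
    exact (mem_rootedTrees.1 h₂).1 u fun h => hu (mem_sdiff.1 h).1
  by_cases huC : u ∈ C
  · rw [← subtreeAt_graft_self hv hCS hwC h₁ h₂, mem_subtreeAt] at huC
    exact huC.trans (Reaches.head (by rw [graft_self]; exact Reaches.refl _ _))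
  · have hu' : u ∈ S \ C := mem_sdiff.2 ⟨hu, huC⟩
    refine ((mem_rootedTrees.1 h₂).2 u hu').congr_on
      (A := insert v (S \ C : Finset V)) (Or.inr hu') fun x hx hxv => ?_
    have hx' : x ∈ S \ C := hx.resolve_left hxv
    refine ⟨(graft_of_notMem hwC (mem_sdiff.1 hx').2).symm, ?_⟩
    have := parent_mem (fun h => hv (mem_sdiff.1 h).1) h₂ hx'
    rwa [← mem_coe, coe_insert] at this

theorem subtreeAt_graft_of_mem (hv : v ∉ S) (hCS : C ⊆ S) (hwC : w ∈ C)
    (h₁ : p₁ ∈ rootedTrees w (C.erase w)) (h₂ : p₂ ∈ rootedTrees v (S \ C))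
    {u : V} (hu : u ∈ C.erase w) :
    subtreeAt (graft v w C p₁ p₂) u = subtreeAt p₁ u := by
  have huC := mem_of_mem_erase hu
  have fix : ∀ x, x ∉ C.erase w → p₁ x = x := (mem_rootedTrees.1 h₁).1
  ext x
  rw [mem_subtreeAt, mem_subtreeAt]
  constructor
  · intro h
    refine h.head_induction (P := fun x => Reaches p₁ x u) (Reaches.refl _ _)
      fun x _ _ ih => ?_
    have outside : ∀ y, y ∉ C → ¬ Reaches p₁ y u := fun y hy hr =>
      hy (hr.eq_of_fixed (fix y fun h => hy (mem_of_mem_erase h)) ▸ huC)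
    by_cases hxw : x = w
    · rw [hxw, graft_self] at ih
      exact absurd ih (outside v fun h => hv (hCS h))
    by_cases hxC : x ∈ C
    · rw [graft_of_mem (mem_erase.2 ⟨hxw, hxC⟩)] at ih
      exact ih.head
    · rw [graft_of_notMem hwC hxC] at ih
      exact absurd ih (outside _ (parent_notMem_of_notMem hv hCS h₂ hxC))
  · intro h
    refine h.head_induction (P := fun x => Reaches (graft v w C p₁ p₂) x u)
      (Reaches.refl _ _) fun x _ _ ih => ?_
    by_cases hx : x ∈ C.erase w
    · exact Reaches.head ((graft_of_mem hx).symm ▸ ih)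
    · rwa [fix x hx] at ih

theorem subtreeAt_graft_of_mem_sdiff (hv : v ∉ S) (hwC : w ∈ C)
    (h₁ : p₁ ∈ rootedTrees w (C.erase w)) (h₂ : p₂ ∈ rootedTrees v (S \ C))
    {u : V} (hu : u ∈ S \ C) :
    subtreeAt (graft v w C p₁ p₂) u = subtreeAt p₂ u := by
  have hu' := mem_sdiff.1 hu
  have fix : ∀ x, x ∉ S \ C → p₂ x = x := (mem_rootedTrees.1 h₂).1
  ext x
  rw [mem_subtreeAt, mem_subtreeAt]
  constructor
  · intro h
    refine h.head_induction (P := fun x => Reaches p₂ x u) (Reaches.refl _ _)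
      fun x _ _ ih => ?_
    have outside : ∀ y, y ∉ S \ C → ¬ Reaches p₂ y u := fun y hy hr =>
      hy (hr.eq_of_fixed (fix y hy) ▸ hu)
    by_cases hxw : x = w
    · rw [hxw, graft_self] at ih
      exact absurd ih (outside v fun h => hv (mem_sdiff.1 h).1)
    by_cases hxC : x ∈ C
    · have hx := mem_erase.2 ⟨hxw, hxC⟩
      rw [graft_of_mem hx] at ih
      exact absurd ih
        (outside _ fun h => (mem_sdiff.1 h).2 (mem_of_parent_mem_erase hwC h₁ hx))
    · rw [graft_of_notMem hwC hxC] at ih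
      exact ih.head
  · intro h
    refine h.head_induction (P := fun x => Reaches (graft v w C p₁ p₂) x u)
      (Reaches.refl _ _) fun x _ _ ih => ?_
    by_cases hx : x ∈ C
    · rwa [fix x fun h => (mem_sdiff.1 h).2 hx] at ih
    · exact Reaches.head ((graft_of_notMem hwC hx).symm ▸ ih)

end Graft

variable {R : Type*} [CommSemiring R]

/-- The sum over the trees on `insert v S` rooted at `v` of the products of the local weights
`W (parent of w) w (subtree at w)`. -/
def treeSum (W : V → V → Finset V → R) (v : V) (S : Finset V) : R :=
  ∑ p ∈ rootedTrees v S, ∏ w ∈ S, W (p w) w (subtreeAt p w)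

theorem treeSum_empty (W : V → V → Finset V → R) (v : V) : treeSum W v ∅ = 1 := by
  have : rootedTrees v (∅ : Finset V) = {id} := by
    ext p
    simp [mem_rootedTrees, funext_iff]
  simp [treeSum, this]

theorem sum_rootedTrees_of_branch (W : V → V → Finset V → R) {v w : V} {S C : Finset V}
    (hv : v ∉ S) (hCS : C ⊆ S) (hwC : w ∈ C) :
    ∑ p ∈ (rootedTrees v S).filter (fun p => p w = v ∧ subtreeAt p w = C),
        ∏ u ∈ S, W (p u) u (subtreeAt p u) =
      W v w C * treeSum W w (C.erase w) * treeSum W v (S \ C) := by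
  rw [treeSum, treeSum, mul_assoc, sum_mul_sum, ← sum_product', mul_sum]
  symm
  refine sum_bij' (fun x _ => graft v w C x.1 x.2)
    (fun p _ => (restrictMap p (C.erase w), restrictMap p (S \ C))) ?_ ?_ ?_ ?_ ?_
  · rintro ⟨p₁, p₂⟩ hx
    rw [mem_product] at hx
    exact mem_filter.2 ⟨graft_mem hv hCS hwC hx.1 hx.2, graft_self,
      subtreeAt_graft_self hv hCS hwC hx.1 hx.2⟩
  · intro p hp
    obtain ⟨hp, -, hC⟩ := mem_filter.1 hp
    exact mem_product.2 ⟨restrictMap_erase_mem hwC hC, restrictMap_sdiff_mem hv hp hC⟩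
  · rintro ⟨p₁, p₂⟩ hx
    rw [mem_product] at hx
    refine Prod.ext (funext fun u => ?_) (funext fun u => ?_)
    · by_cases hu : u ∈ C.erase w
      · exact (if_pos hu).trans (graft_of_mem hu)
      · exact (if_neg hu).trans ((mem_rootedTrees.1 hx.1).1 u hu).symm
    · by_cases hu : u ∈ S \ C
      · exact (if_pos hu).trans (graft_of_notMem hwC (mem_sdiff.1 hu).2)
      · exact (if_neg hu).trans ((mem_rootedTrees.1 hx.2).1 u hu).symm
  · intro p hp
    obtain ⟨hp, hpw, hC⟩ := mem_filter.1 hp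
    funext u
    by_cases huw : u = w
    · rw [huw, graft_self, hpw]
    by_cases huC : u ∈ C
    · have hu : u ∈ C.erase w := mem_erase.2 ⟨huw, huC⟩
      rw [graft_of_mem hu]
      exact if_pos hu
    · rw [graft_of_notMem hwC huC]
      by_cases huS : u ∈ S
      · exact if_pos (mem_sdiff.2 ⟨huS, huC⟩)
      · exact (if_neg fun h => huS (mem_sdiff.1 h).1).trans ((mem_rootedTrees.1 hp).1 u huS).symm
  · rintro ⟨p₁, p₂⟩ hx
    rw [mem_product] at hx
    rw [← prod_sdiff hCS, ← mul_prod_erase C _ hwC, graft_self,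
      subtreeAt_graft_self hv hCS hwC hx.1 hx.2, mul_comm (∏ u ∈ S \ C, _), mul_assoc]
    congr 2
    · refine prod_congr rfl fun u hu => ?_
      rw [graft_of_mem hu, subtreeAt_graft_of_mem hv hCS hwC hx.1 hx.2 hu]
    · refine prod_congr rfl fun u hu => ?_
      rw [graft_of_notMem hwC (mem_sdiff.1 hu).2,
        subtreeAt_graft_of_mem_sdiff hv hwC hx.1 hx.2 hu]

theorem exists_branch {v a : V} {S : Finset V} {p : V → V} (hv : v ∉ S)
    (hp : p ∈ rootedTrees v S) (ha : a ∈ S) : ∃ w ∈ S, p w = v ∧ Reaches p a w := by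
  have key : a ∈ S → ∃ w ∈ S, p w = v ∧ Reaches p a w := by
    refine ((mem_rootedTrees.1 hp).2 a ha).head_induction
      (P := fun x => x ∈ S → ∃ w ∈ S, p w = v ∧ Reaches p x w) (fun h => absurd h hv) ?_
    intro x _ _ ih hx
    rcases mem_insert.1 (parent_mem hv hp hx) with h | h
    · exact ⟨x, hx, h, Reaches.refl _ _⟩
    · obtain ⟨w, hw, hpw, hr⟩ := ih h
      exact ⟨w, hw, hpw, hr.head⟩
  exact key ha

theorem branch_unique {v a w w' : V} {S : Finset V} {p : V → V} (hv : v ∉ S)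
    (hp : p ∈ rootedTrees v S) (hw : w ∈ S) (hw' : w' ∈ S) (hpw : p w = v) (hpw' : p w' = v)
    (h : Reaches p a w) (h' : Reaches p a w') : w = w' := by
  have hfix : p v = v := (mem_rootedTrees.1 hp).1 v hv
  by_contra hne
  rcases h.total h' with hr | hr
  · have := hr.tail_of_ne hne
    rw [hpw] at this
    exact hv (this.eq_of_fixed hfix ▸ hw')
  · have := hr.tail_of_ne (Ne.symm hne)
    rw [hpw'] at this
    exact hv (this.eq_of_fixed hfix ▸ hw)

/-- Splitting off the branch at the root that contains `a`. -/
theorem treeSum_eq_sum_branch (W : V → V → Finset V → R) {v a : V} {S : Finset V}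
    (hv : v ∉ S) (ha : a ∈ S) :
    treeSum W v S = ∑ C ∈ S.powerset with a ∈ C,
      (∑ w ∈ C, W v w C * treeSum W w (C.erase w)) * treeSum W v (S \ C) := by
  have hex : ∀ p, ∃ w, p ∈ rootedTrees v S → w ∈ S ∧ p w = v ∧ Reaches p a w := by
    intro p
    by_cases hp : p ∈ rootedTrees v S
    · obtain ⟨w, h⟩ := exists_branch hv hp ha
      exact ⟨w, fun _ => h⟩
    · exact ⟨a, fun h => absurd h hp⟩
  choose b hb using hex
  have hmaps : ∀ p ∈ rootedTrees v S, (⟨subtreeAt p (b p), b p⟩ : Σ _ : Finset V, V) ∈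
      (S.powerset.filter (a ∈ ·)).sigma fun C => C := by
    intro p hp
    obtain ⟨h1, -, h3⟩ := hb p hp
    simp only [mem_sigma, mem_filter, mem_powerset, mem_subtreeAt]
    exact ⟨⟨subtreeAt_subset hp h1, h3⟩, Reaches.refl _ _⟩
  rw [treeSum, ← sum_fiberwise_of_maps_to hmaps, sum_sigma]
  refine sum_congr rfl fun C hC => ?_
  rw [sum_mul]
  refine sum_congr rfl fun w hwC => ?_
  rw [mem_filter, mem_powerset] at hC
  rw [← sum_rootedTrees_of_branch W hv hC.1 hwC]
  refine sum_congr (filter_congr fun p hp => ?_) fun _ _ => rfl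
  obtain ⟨h1, h2, h3⟩ := hb p hp
  constructor
  · intro h
    simp only [Sigma.mk.injEq, heq_eq_eq] at h
    obtain ⟨h, rfl⟩ := h
    exact ⟨h2, h⟩
  · rintro ⟨hpw, rfl⟩
    have := branch_unique hv hp h1 (hC.1 hwC) h2 hpw h3 (mem_subtreeAt.1 hC.2)
    rw [this]

end Trees

/-! ### Independence of the root -/

section Powerset

variable {V R : Type*} [DecidableEq V] [AddCommMonoid R]

theorem sum_powerset_disjoint_comm (B : Finset V) (F : Finset V → Finset V → R) :
    ∑ C ∈ B.powerset, ∑ D ∈ (B \ C).powerset, F C D =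
      ∑ D ∈ B.powerset, ∑ C ∈ (B \ D).powerset, F C D := by
  refine sum_comm' fun C D => ?_
  simp only [mem_powerset, subset_sdiff]
  exact ⟨fun h => ⟨⟨h.1, h.2.2.symm⟩, h.2.1⟩, fun h => ⟨h.1.1, h.2, h.1.2.symm⟩⟩

theorem sum_powerset_powerset_sdiff (S : Finset V) (F : Finset V → Finset V → R) :
    ∑ T ∈ S.powerset, ∑ C ∈ T.powerset, F C (T \ C) =
      ∑ C ∈ S.powerset, ∑ U ∈ (S \ C).powerset, F C U := by
  rw [sum_sigma', sum_sigma']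
  refine sum_bij' (fun x _ => ⟨x.2, x.1 \ x.2⟩) (fun x _ => ⟨x.1 ∪ x.2, x.1⟩) ?_ ?_ ?_ ?_ ?_
  · rintro ⟨T, C⟩ h
    simp only [mem_sigma, mem_powerset] at h ⊢
    exact ⟨h.2.trans h.1, sdiff_subset_sdiff h.1 subset_rfl⟩
  · rintro ⟨C, U⟩ h
    simp only [mem_sigma, mem_powerset] at h ⊢
    exact ⟨union_subset h.1 (h.2.trans sdiff_subset), subset_union_left⟩
  · rintro ⟨T, C⟩ h
    simp only [mem_sigma, mem_powerset] at h
    simp [union_sdiff_of_subset h.2]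
  · rintro ⟨C, U⟩ h
    simp only [mem_sigma, mem_powerset, subset_sdiff] at h
    simp [union_sdiff_cancel_left h.2.2.symm]
  · rintro ⟨T, C⟩ _
    rfl

end Powerset

section Nq

variable {V R : Type*}

theorem nq_mul_sub_one [CommRing R] (q : R) (m : ℕ) : (q - 1) * nq q m = q ^ m - 1 := by
  rw [mul_comm]
  exact geom_sum_mul q m

theorem nq_add [CommSemiring R] (q : R) (m n : ℕ) : nq q (m + n) = nq q m + nq q n * q ^ m := by
  simp only [nq, sum_range_add, pow_add, sum_mul, mul_comm]

theorem nq_zero [CommSemiring R] (q : R) : nq q 0 = 0 := sum_range_zero _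

theorem sum_nq_mul_pow [CommSemiring R] [LinearOrder V] (q : R) (f : V → ℕ) (C : Finset V) :
    ∑ w ∈ C, nq q (f w) * q ^ (∑ j ∈ C with j < w, f j) = nq q (∑ w ∈ C, f w) := by
  induction C using Finset.induction_on_max with
  | empty => simp [nq_zero]
  | insert a C ha ih =>
    have haC : a ∉ C := fun h => lt_irrefl a (ha a h)
    have h1 : (insert a C).filter (· < a) = C := by
      ext x
      simp only [mem_filter, mem_insert]
      exact ⟨fun h => h.1.resolve_left h.2.ne, fun h => ⟨Or.inr h, ha x h⟩⟩
    have h2 : ∀ w ∈ C, (insert a C).filter (· < w) = C.filter (· < w) := by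
      intro w hw
      rw [filter_insert, if_neg (ha w hw).not_gt]
    rw [sum_insert haC, sum_insert haC, h1, add_comm (f a), nq_add, ← ih, add_comm]
    congr 1
    exact sum_congr rfl fun w hw => by rw [h2 w hw]

theorem sum_first_nq [CommSemiring R] [LinearOrder V] (q : R) (f : V → ℕ) (C : Finset V) :
    (∑ w ∈ C, if 0 < f w ∧ ∀ j ∈ C, j < w → f j = 0 then nq q (∑ u ∈ C, f u) else 0) =
      nq q (∑ w ∈ C, f w) := by
  by_cases h : (C.filter fun w => 0 < f w).Nonempty
  · obtain ⟨hm, hm'⟩ := mem_filter.1 (min'_mem _ h)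
    rw [sum_eq_single_of_mem (min' _ h) hm, if_pos]
    · refine ⟨hm', fun j hj hlt => ?_⟩
      by_contra hne
      exact (min'_le _ j (mem_filter.2 ⟨hj, Nat.pos_of_ne_zero hne⟩)).not_gt hlt
    · intro w hw hne
      refine if_neg fun hw' => ?_
      have h1 : min' _ h ≤ w := min'_le _ w (mem_filter.2 ⟨hw, hw'.1⟩)
      exact hm'.ne' (hw'.2 _ hm (lt_of_le_of_ne h1 (Ne.symm hne)))
  · have hz : ∀ w ∈ C, f w = 0 := fun w hw => by
      by_contra hne
      exact h ⟨w, mem_filter.2 ⟨hw, Nat.pos_of_ne_zero hne⟩⟩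
    rw [sum_eq_zero hz, nq_zero]
    simp

end Nq

section Edges

variable {V : Type*} [LinearOrder V]

/-- The number of non-loop edges inside `S`, for the edge multiplicities `e`. -/
def innerEdges (e : V → V → ℕ) (S : Finset V) : ℕ := ∑ i ∈ S, ∑ j ∈ S with j < i, e i j

theorem innerEdges_insert {e : V → V → ℕ} (he : ∀ i j, e i j = e j i) {v : V} {S : Finset V}
    (hv : v ∉ S) : innerEdges e (insert v S) = (∑ u ∈ S, e u v) + innerEdges e S := by
  have h1 : ∀ i ∈ S, ∑ j ∈ insert v S with j < i, e i j =
      (if v < i then e i v else 0) + ∑ j ∈ S with j < i, e i j := by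
    intro i _
    rw [filter_insert]
    split_ifs with h
    · rw [sum_insert fun h' => hv (mem_filter.1 h').1]
    · rw [zero_add]
  have h2 : ∑ j ∈ insert v S with j < v, e v j = ∑ j ∈ S, if j < v then e j v else 0 := by
    rw [filter_insert, if_neg (lt_irrefl v), sum_filter]
    exact sum_congr rfl fun j _ => by rw [he v j]
  rw [innerEdges, sum_insert hv, h2, sum_congr rfl h1, sum_add_distrib, ← add_assoc,
    ← sum_add_distrib, innerEdges]
  congr 1
  refine sum_congr rfl fun u hu => ?_
  rcases lt_or_gt_of_ne (ne_of_mem_of_not_mem hu hv) with h | h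
  · simp [h, h.not_gt]
  · simp [h, h.not_gt]

end Edges

section RootIndependence

variable {V R : Type*} [LinearOrder V] [CommRing R]

/-- The decomposition of the weight of `insert v S` by the component of `v`
(`y` weighs the component, `q ^ innerEdges` the rest), given that of the subsets of `S`. -/
theorem sum_mul_pow_innerEdges {e : V → V → ℕ} (he : ∀ i j, e i j = e j i) (q : R)
    {K y : Finset V → R} {v : V} {S : Finset V} (hv : v ∉ S) (hy : y ∅ = 1)
    (hrec : ∀ T ⊆ S, ∀ a ∈ T, y T =
      ∑ C ∈ T.powerset, if a ∈ C then (q ^ (∑ u ∈ C, e u v) - 1) * K C * y (T \ C) else 0)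
    (hK : ∀ T ⊆ S, ∀ a ∈ T,
      ∑ C ∈ T.powerset, (if a ∈ C then K C * q ^ innerEdges e (T \ C) else 0) =
        q ^ innerEdges e T) :
    ∑ T ∈ S.powerset, y T * q ^ innerEdges e (S \ T) = q ^ innerEdges e (insert v S) := by
  induction S using Finset.strongInduction with
  | H S ih =>
  rcases S.eq_empty_or_nonempty with rfl | ⟨a, ha⟩
  · simp [hy, innerEdges, filter_singleton]
  have hsplit : ∀ T ∈ S.powerset, y T * q ^ innerEdges e (S \ T) =
      (∑ C ∈ T.powerset, if a ∈ C then (q ^ (∑ u ∈ C, e u v) - 1) * K C *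
        (y (T \ C) * q ^ innerEdges e ((S \ C) \ (T \ C))) else 0) +
      ∑ C ∈ (S \ T).powerset, if a ∈ C then K C *
        (y T * q ^ innerEdges e ((S \ C) \ T)) else 0 := by
    intro T hT
    rw [mem_powerset] at hT
    by_cases haT : a ∈ T
    · have h0 : ∑ C ∈ (S \ T).powerset, (if a ∈ C then K C *
          (y T * q ^ innerEdges e ((S \ C) \ T)) else 0) = 0 := by
        refine sum_eq_zero fun C hC => if_neg fun h => ?_
        exact (mem_sdiff.1 (mem_powerset.1 hC h)).2 haT
      rw [h0, add_zero, hrec T hT a haT, sum_mul]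
      refine sum_congr rfl fun C hC => ?_
      have : (S \ C) \ (T \ C) = S \ T := by
        have := mem_powerset.1 hC
        ext x
        simp only [mem_sdiff]
        have h2 := @this x
        tauto
      rw [this]
      split_ifs
      · ring
      · ring
    · have h0 : ∑ C ∈ T.powerset, (if a ∈ C then (q ^ (∑ u ∈ C, e u v) - 1) * K C *
        (y (T \ C) * q ^ innerEdges e ((S \ C) \ (T \ C))) else 0) = 0 :=
        sum_eq_zero fun C hC => if_neg fun h => haT (mem_powerset.1 hC h)
      rw [h0, zero_add, ← hK _ sdiff_subset a (mem_sdiff.2 ⟨ha, haT⟩), mul_sum]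
      refine sum_congr rfl fun C _ => ?_
      rw [sdiff_right_comm]
      split_ifs
      · ring
      · ring
  rw [sum_congr rfl hsplit, sum_add_distrib,
    sum_powerset_powerset_sdiff S (fun C U => if a ∈ C then (q ^ (∑ u ∈ C, e u v) - 1) * K C *
        (y U * q ^ innerEdges e ((S \ C) \ U)) else 0),
    sum_powerset_disjoint_comm S (fun T C => if a ∈ C then K C *
        (y T * q ^ innerEdges e ((S \ C) \ T)) else 0), ← sum_add_distrib,
    innerEdges_insert he hv, pow_add, ← hK S subset_rfl a ha, mul_sum]
  refine sum_congr rfl fun C hC => ?_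
  rw [mem_powerset] at hC
  split_ifs with haC
  · have hlt : S \ C ⊂ S := sdiff_ssubset hC ⟨a, haC⟩
    have hvC : v ∉ S \ C := fun h => hv (mem_sdiff.1 h).1
    rw [← mul_sum, ← mul_sum, ih _ hlt hvC (fun T hT => hrec T (hT.trans hlt.subset))
      (fun T hT => hK T (hT.trans hlt.subset)), innerEdges_insert he hvC, pow_add,
      ← sum_sdiff hC, pow_add]
    ring
  · simp

/-- If `L v S` satisfies the recursion obtained by splitting off the branch at the root `v`
containing a given point, and the branch weights add up to `nq q` of the number of edges to the
root, then `L` does not depend on the choice of the root. -/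
theorem root_independent [IsDomain R] {e : V → V → ℕ} (he : ∀ i j, e i j = e j i) {q : R}
    (hq : q ≠ 1) {L : V → Finset V → R} {W : V → V → Finset V → R}
    (hW : ∀ v C, ∑ w ∈ C, W v w C = nq q (∑ u ∈ C, e u v))
    (hL : ∀ v, L v ∅ = 1)
    (hrec : ∀ v S a, v ∉ S → a ∈ S → L v S = ∑ C ∈ S.powerset with a ∈ C,
      (∑ w ∈ C, W v w C * L w (C.erase w)) * L v (S \ C))
    (B : Finset V) {v w : V} (hv : v ∈ B) (hw : w ∈ B) :
    L v (B.erase v) = L w (B.erase w) := by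
  have hq' : q - 1 ≠ 0 := sub_ne_zero.2 hq
  let y : V → Finset V → R := fun v S => (q - 1) ^ S.card * L v S
  suffices main : ∀ B : Finset V, (∀ v ∈ B, ∑ T ∈ (B.erase v).powerset,
      y v T * q ^ innerEdges e (B.erase v \ T) = q ^ innerEdges e B) ∧
      ∀ v ∈ B, ∀ w ∈ B, y v (B.erase v) = y w (B.erase w) by
    have h := (main B).2 v hv w hw
    simp only [y, card_erase_of_mem hv, card_erase_of_mem hw] at h
    exact mul_left_cancel₀ (pow_ne_zero _ hq') h
  clear! v w B
  intro B
  induction B using Finset.strongInduction with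
  | H B ih =>
  let K : Finset V → R := fun C => if h : C.Nonempty then y h.choose (C.erase h.choose) else 0
  have hKy : ∀ C, C ⊂ B → ∀ w ∈ C, y w (C.erase w) = K C := by
    intro C hC w hw
    have hne : C.Nonempty := ⟨w, hw⟩
    simp only [K, dif_pos hne]
    exact (ih C hC).2 w hw _ hne.choose_spec
  have herase : ∀ (D : Finset V) (a : V), a ∈ D → ∀ F : Finset V → R,
      ∑ T ∈ (D.erase a).powerset, F (insert a T) = ∑ C ∈ D.powerset, if a ∈ C then F C else 0 := by
    intro D a ha F
    symm
    conv_lhs => rw [← insert_erase ha, sum_powerset_insert (notMem_erase a D)]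
    rw [sum_eq_zero, zero_add]
    · exact sum_congr rfl fun T _ => if_pos (mem_insert_self a T)
    · intro T hT
      exact if_neg fun h => notMem_erase a D (mem_powerset.1 hT h)
  have hconv : ∀ (D : Finset V) (a : V), a ∈ D →
      ∑ T ∈ (D.erase a).powerset, y a T * q ^ innerEdges e (D.erase a \ T) =
        ∑ C ∈ D.powerset, if a ∈ C then y a (C.erase a) * q ^ innerEdges e (D \ C) else 0 := by
    intro D a ha
    rw [← herase D a ha]
    refine sum_congr rfl fun T hT => ?_
    have haT : a ∉ T := fun h => notMem_erase a D (mem_powerset.1 hT h)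
    rw [erase_insert haT, erase_sdiff_comm, sdiff_insert]
  have hKsum : ∀ T, T ⊂ B → ∀ a ∈ T,
      ∑ C ∈ T.powerset, (if a ∈ C then K C * q ^ innerEdges e (T \ C) else 0) =
        q ^ innerEdges e T := by
    intro T hT a ha
    rw [← (ih T hT).1 a ha, hconv T a ha]
    refine sum_congr rfl fun C hC => ?_
    split_ifs with haC
    · rw [hKy C (lt_of_le_of_lt (mem_powerset.1 hC) hT) a haC]
    · rfl
  have hP : ∀ v ∈ B, ∑ T ∈ (B.erase v).powerset,
      y v T * q ^ innerEdges e (B.erase v \ T) = q ^ innerEdges e B := by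
    intro v hv
    have hlt := erase_ssubset hv
    rw [sum_mul_pow_innerEdges he q (K := K) (notMem_erase v B) (by simp [y, hL]) ?_
      fun T hT => hKsum T (lt_of_le_of_lt hT hlt), insert_erase hv]
    intro T hT a ha
    have hvT : v ∉ T := fun h => notMem_erase v B (hT h)
    simp only [y]
    rw [hrec v T a hvT ha, sum_filter, mul_sum]
    refine sum_congr rfl fun C hC => ?_
    rw [mem_powerset] at hC
    split_ifs with haC
    · have hCB : C ⊂ B := lt_of_le_of_lt (hC.trans hT) hlt
      have hcard : T.card = 1 + (C.card - 1) + (T \ C).card := by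
        have h1 := card_sdiff_add_card_eq_card hC
        have h2 := card_pos.2 ⟨a, haC⟩
        omega
      have hsum : (q - 1) ^ (C.card - 1) * ∑ w ∈ C, W v w C * L w (C.erase w) =
          nq q (∑ u ∈ C, e u v) * K C := by
        rw [← hW, sum_mul, mul_sum]
        refine sum_congr rfl fun w hw => ?_
        rw [← hKy C hCB w hw]
        simp only [y, card_erase_of_mem hw]
        ring
      rw [hcard, pow_add, pow_add, pow_one, ← nq_mul_sub_one]
      linear_combination (q - 1) * (q - 1) ^ (T \ C).card * L v (T \ C) * hsum
    · ring
  refine ⟨hP, fun v hv w hw => ?_⟩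
  by_cases hvw : v = w
  · rw [hvw]
  let N : V → V → R := fun a b => ∑ C ∈ B.powerset, ∑ D ∈ (B \ C).powerset,
    if a ∈ C ∧ b ∈ D then K C * K D * q ^ innerEdges e ((B \ C) \ D) else 0
  let M : V → V → R := fun a b => ∑ C ∈ B.powerset.erase B,
    if a ∈ C ∧ b ∈ C then K C * q ^ innerEdges e (B \ C) else 0
  have hN : N v w = N w v := by
    simp only [N]
    rw [sum_powerset_disjoint_comm]
    refine sum_congr rfl fun C _ => sum_congr rfl fun D _ => ?_
    simp only [sdiff_right_comm, mul_comm (K D), and_comm]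
  have hM : M v w = M w v := by simp only [M, and_comm]
  have key : ∀ a ∈ B, ∀ b ∈ B, a ≠ b →
      q ^ innerEdges e B = y a (B.erase a) + M a b + N a b := by
    intro a ha b hb hab
    have hNB : N a b = ∑ C ∈ B.powerset.erase B, ∑ D ∈ (B \ C).powerset,
        if a ∈ C ∧ b ∈ D then K C * K D * q ^ innerEdges e ((B \ C) \ D) else 0 := by
      simp only [N]
      rw [← add_sum_erase _ _ (mem_powerset_self B)]
      simp
    rw [← hP a ha, hconv B a ha, ← add_sum_erase _ _ (mem_powerset_self B), if_pos ha,
      sdiff_self, hNB, add_assoc]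
    congr 1
    · simp [innerEdges]
    rw [← sum_add_distrib]
    refine sum_congr rfl fun C hC => ?_
    obtain ⟨hne, hCB⟩ := mem_erase.1 hC
    rw [mem_powerset] at hCB
    by_cases haC : a ∈ C
    · rw [if_pos haC, hKy C (hCB.ssubset_of_ne hne) a haC]
      by_cases hbC : b ∈ C
      · rw [if_pos ⟨haC, hbC⟩, sum_eq_zero, add_zero]
        intro D hD
        exact if_neg fun h => (mem_sdiff.1 (mem_powerset.1 hD h.2)).2 hbC
      · rw [if_neg fun h => hbC h.2, zero_add, ← hKsum (B \ C) (sdiff_ssubset hCB ⟨a, haC⟩) b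
          (mem_sdiff.2 ⟨hb, hbC⟩), mul_sum]
        refine sum_congr rfl fun D _ => ?_
        simp only [haC, true_and]
        split_ifs
        · ring
        · ring
    · simp [haC]
  have h1 := key v hv w hw hvw
  have h2 := key w hw v hv (Ne.symm hvw)
  linear_combination h2 - h1 - hM - hN

/-- Two solutions of the branch recursion whose weights have the same branch sums agree. -/
theorem eq_of_branch_recursion [IsDomain R] {e : V → V → ℕ} (he : ∀ i j, e i j = e j i) {q : R}
    (hq : q ≠ 1) {L L' : V → Finset V → R} {W W' : V → V → Finset V → R}
    (hW : ∀ v C, ∑ w ∈ C, W v w C = nq q (∑ u ∈ C, e u v))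
    (hW' : ∀ v C, ∑ w ∈ C, W' v w C = nq q (∑ u ∈ C, e u v))
    (hL : ∀ v, L v ∅ = 1) (hL' : ∀ v, L' v ∅ = 1)
    (hrec : ∀ v S a, v ∉ S → a ∈ S → L v S = ∑ C ∈ S.powerset with a ∈ C,
      (∑ w ∈ C, W v w C * L w (C.erase w)) * L v (S \ C))
    (hrec' : ∀ v S a, v ∉ S → a ∈ S → L' v S = ∑ C ∈ S.powerset with a ∈ C,
      (∑ w ∈ C, W' v w C * L' w (C.erase w)) * L' v (S \ C))
    {v : V} {S : Finset V} (hv : v ∉ S) : L v S = L' v S := by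
  induction S using Finset.strongInduction generalizing v with
  | H S ih =>
  rcases S.eq_empty_or_nonempty with rfl | ⟨a, ha⟩
  · rw [hL, hL']
  rw [hrec v S a hv ha, hrec' v S a hv ha]
  refine sum_congr rfl fun C hC => ?_
  rw [mem_filter, mem_powerset] at hC
  obtain ⟨hCS, haC⟩ := hC
  rw [ih _ (sdiff_ssubset hCS ⟨a, haC⟩) fun h => hv (mem_sdiff.1 h).1]
  congr 1
  have hconst : ∀ w ∈ C, L w (C.erase w) = L a (C.erase a) := fun w hw =>
    root_independent he hq hW hL hrec C hw haC
  have hconst' : ∀ w ∈ C, L' w (C.erase w) = L a (C.erase a) := fun w hw =>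
    (ih _ ((erase_ssubset hw).trans_subset hCS) (notMem_erase w C)).symm.trans (hconst w hw)
  calc ∑ w ∈ C, W v w C * L w (C.erase w) = (∑ w ∈ C, W v w C) * L a (C.erase a) := by
        rw [sum_mul]
        exact sum_congr rfl fun w hw => by rw [hconst w hw]
    _ = (∑ w ∈ C, W' v w C) * L a (C.erase a) := by rw [hW, hW']
    _ = ∑ w ∈ C, W' v w C * L' w (C.erase w) := by
        rw [sum_mul]
        exact sum_congr rfl fun w hw => by rw [hconst' w hw]

end RootIndependence

/-! ### The two tree sums -/

section InversionPolynomial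

variable {r : ℕ} {R : Type*} [CommSemiring R]

/-- The local weight of a tree in the `G`-inversion polynomial. -/
def inversionWeight (e : Fin (r+1) → Fin (r+1) → ℕ) (q : R) (v w : Fin (r+1))
    (C : Finset (Fin (r+1))) : R :=
  nq q (e w v) * q ^ (∑ j ∈ C with j < w, e j v)

/-- The local weight of a tree in the sum over trees without `κ`-inversion. -/
def inversionFreeWeight (e : Fin (r+1) → Fin (r+1) → ℕ) (q : R) (v w : Fin (r+1))
    (C : Finset (Fin (r+1))) : R :=
  if 0 < e w v ∧ ∀ j ∈ C, j < w → e j v = 0 then nq q (∑ u ∈ C, e u v) else 0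

theorem mem_parentMaps {e : Fin (r+1) → Fin (r+1) → ℕ} {p : Fin (r+1) → Fin (r+1)} :
    p ∈ parentMaps e ↔
      p ∈ rootedTrees 0 (univ.erase 0) ∧ ∀ w ∈ univ.erase 0, 0 < e w (p w) := by
  simp only [parentMaps, mem_rootedTrees, mem_filter, mem_univ, true_and, mem_erase, and_true,
    not_not]
  constructor
  · rintro ⟨h0, h1, h2⟩
    exact ⟨⟨fun u hu => hu ▸ h0, fun u _ => h2 u⟩, fun w hw => (h1 w hw).2⟩
  · rintro ⟨⟨h0, h1⟩, h2⟩
    refine ⟨h0 0 rfl, fun w hw => ⟨fun h => hw ?_, h2 w hw⟩, fun w => ?_⟩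
    · exact (h1 w hw).eq_of_fixed h
    · by_cases hw : w = 0
      · exact hw ▸ Reaches.refl _ _
      · exact h1 w hw

theorem isKappaInv_iff {e : Fin (r+1) → Fin (r+1) → ℕ} {p : Fin (r+1) → Fin (r+1)}
    (hp : p ∈ rootedTrees 0 (univ.erase 0)) {i j : Fin (r+1)} :
    isKappaInv e p i j ↔ i ∈ univ.erase 0 ∧ j ∈ subtreeAt p i ∧ j < i ∧ 0 < e j (p i) := by
  have h0 : p 0 = 0 := (mem_rootedTrees.1 hp).1 0 (notMem_erase _ _)
  rw [isKappaInv, mem_subtreeAt, mem_erase]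
  constructor
  · rintro ⟨hi, -, -, hr, hlt, -, hpos⟩
    exact ⟨⟨hi, mem_univ i⟩, hr, hlt, hpos⟩
  · rintro ⟨⟨hi, -⟩, hr, hlt, hpos⟩
    refine ⟨hi, ?_, hlt.ne', hr, hlt, ?_, hpos⟩
    · rintro rfl
      exact hi (hr.eq_of_fixed h0).symm
    · rintro rfl
      have hroot := (mem_rootedTrees.1 hp).2 i (mem_erase.2 ⟨hi, mem_univ i⟩)
      exact hi ((hr.of_cycle hroot).eq_of_fixed h0).symm

theorem kappaStat_eq {e : Fin (r+1) → Fin (r+1) → ℕ} (he : ∀ i j, e i j = e j i)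
    {p : Fin (r+1) → Fin (r+1)} (hp : p ∈ rootedTrees 0 (univ.erase 0)) :
    kappaStat e p = ∑ w ∈ univ.erase 0, ∑ j ∈ subtreeAt p w with j < w, e j (p w) := by
  rw [kappaStat, sum_sigma']
  refine sum_bij_ne_zero (fun x _ _ => ⟨x.1, x.2⟩) ?_ ?_ ?_ ?_
  · rintro ⟨i, j⟩ h _
    rw [mem_filter] at h
    obtain ⟨hi, hj, hlt, -⟩ := (isKappaInv_iff hp).1 h.2
    exact mem_sigma.2 ⟨hi, mem_filter.2 ⟨hj, hlt⟩⟩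
  · rintro ⟨i, j⟩ _ _ ⟨i', j'⟩ _ _ h
    simpa using h
  · rintro ⟨i, j⟩ h hne
    obtain ⟨hi, h⟩ := mem_sigma.1 h
    obtain ⟨hj, hlt⟩ := mem_filter.1 h
    refine ⟨(i, j), mem_filter.2 ⟨by simp, (isKappaInv_iff hp).2
      ⟨hi, hj, hlt, Nat.pos_of_ne_zero hne⟩⟩, ?_, rfl⟩
    rwa [he]
  · rintro ⟨i, j⟩ _ _
    exact he _ _

theorem Iinv_eq_treeSum {e : Fin (r+1) → Fin (r+1) → ℕ} (he : ∀ i j, e i j = e j i) (q : R) :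
    Iinv e q = q ^ (∑ i, e i i) * treeSum (inversionWeight e q) 0 (univ.erase 0) := by
  rw [Iinv, treeSum]
  congr 1
  have hsub : parentMaps e ⊆ rootedTrees 0 (univ.erase 0) := fun p hp => (mem_parentMaps.1 hp).1
  rw [← sum_subset hsub]
  · refine sum_congr rfl fun p hp => ?_
    simp only [inversionWeight]
    rw [prod_mul_distrib, prod_pow_eq_pow_sum, kappaStat_eq he (hsub hp), mul_comm]
  · intro p hp hp'
    obtain ⟨w, hw, hz⟩ : ∃ w ∈ univ.erase 0, ¬ 0 < e w (p w) := by
      by_contra! h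
      exact hp' (mem_parentMaps.2 ⟨hp, h⟩)
    refine prod_eq_zero hw ?_
    rw [inversionWeight, Nat.eq_zero_of_not_pos hz, nq_zero, zero_mul]

theorem sum_inversionFree_eq_treeSum (e : Fin (r+1) → Fin (r+1) → ℕ) (q : R) :
    ∑ p ∈ (parentMaps e).filter (fun p => ∀ i j, ¬ isKappaInv e p i j),
        ∏ w ∈ (univ : Finset (Fin (r+1))).erase 0, nq q (deltaStat e p w) =
      treeSum (inversionFreeWeight e q) 0 (univ.erase 0) := by
  rw [treeSum]
  have hsub : (parentMaps e).filter (fun p => ∀ i j, ¬ isKappaInv e p i j) ⊆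
      rootedTrees 0 (univ.erase 0) := fun p hp => (mem_parentMaps.1 (mem_filter.1 hp).1).1
  rw [← sum_subset hsub]
  · refine sum_congr rfl fun p hp => prod_congr rfl fun w hw => ?_
    obtain ⟨hp, hinv⟩ := mem_filter.1 hp
    obtain ⟨hp, hpos⟩ := mem_parentMaps.1 hp
    rw [inversionFreeWeight, if_pos]
    · rfl
    · refine ⟨hpos w hw, fun j hj hlt => ?_⟩
      by_contra hne
      exact hinv w j ((isKappaInv_iff hp).2 ⟨hw, hj, hlt, Nat.pos_of_ne_zero hne⟩)
  · intro p hp hp'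
    obtain ⟨w, hw, hz⟩ : ∃ w ∈ univ.erase 0,
        ¬ (0 < e w (p w) ∧ ∀ j ∈ subtreeAt p w, j < w → e j (p w) = 0) := by
      by_contra! h
      refine hp' (mem_filter.2 ⟨mem_parentMaps.2 ⟨hp, fun w hw => (h w hw).1⟩, fun i j hij => ?_⟩)
      obtain ⟨hi, hj, hlt, hpos⟩ := (isKappaInv_iff hp).1 hij
      exact hpos.ne' ((h i hi).2 j hj hlt)
    exact prod_eq_zero hw (if_neg hz)

end InversionPolynomial

/-- **Proposition 3.1.** For a multigraph `G` on the vertex set `Fin (r+1)` rooted at `0`,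
`𝓘_G(q) = q^{ℓ(G)} Σ_{T : κ(T) = 0} Π_{w ≠ root} [δ_T(w)]_q`,
the sum running over the spanning trees of `G̃` having no `κ`-inversion. -/
theorem stmt4 (r : ℕ) {E : Type*} [Fintype E] (ends : E → Sym2 (Fin (r+1))) :
    Iinv (eCnt ends) (Polynomial.X : Polynomial ℤ) =
      (Polynomial.X : Polynomial ℤ) ^ (∑ i, eCnt ends i i) *
        ∑ p ∈ (parentMaps (eCnt ends)).filter
            (fun p => ∀ i j, ¬ isKappaInv (eCnt ends) p i j),
          ∏ w ∈ (univ : Finset (Fin (r+1))).erase 0,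
            nq (Polynomial.X : Polynomial ℤ) (deltaStat (eCnt ends) p w) := by
  have he : ∀ i j, eCnt ends i j = eCnt ends j i := fun i j => by
    rw [eCnt, eCnt, Sym2.eq_swap]
  rw [Iinv_eq_treeSum he, sum_inversionFree_eq_treeSum]
  congr 1
  exact eq_of_branch_recursion he (q := Polynomial.X) (Polynomial.X_ne_C 1)
    (W := inversionWeight (eCnt ends) Polynomial.X)
    (W' := inversionFreeWeight (eCnt ends) Polynomial.X)
    (fun v C => sum_nq_mul_pow _ (fun u => eCnt ends u v) C)
    (fun v C => by
      simp only [inversionFreeWeight]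
      convert sum_first_nq _ (fun u => eCnt ends u v) C)
    (treeSum_empty _) (treeSum_empty _)
    (fun _ _ _ hv ha => treeSum_eq_sum_branch _ hv ha)
    (fun _ _ _ hv ha => treeSum_eq_sum_branch _ hv ha) (notMem_erase _ _)

end
end
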